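/- Let Λ be a self-injective finite dimensional algebra and N a Λ-module. Then End_Λ(Λ ⊕ N) and End_Λ(Λ ⊕ Ω_Λ(N)) have the same global dimension and the same dominant dimension. -/

import Mathlib

open CategoryTheory CategoryTheory.Limits Opposite

universe u

namespace Rigidity

variable (Λ : Type u) [Ring Λ]

/-- `X` belongs to `add M`: it is a direct summand of a finite direct sum of copies of `M`. -/
def InAdd (M X : ModuleCat.{u} Λ) : Prop :=
  ∃ (r : ℕ) (Y : ModuleCat.{u} Λ), Nonempty ((X ⊞ Y) ≅ ⨁ (fun _ : Fin r => M))

/-- An indecomposable object. -/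
def Indec (X : ModuleCat.{u} Λ) : Prop :=
  ¬ IsZero X ∧ ∀ A B : ModuleCat.{u} Λ, Nonempty (X ≅ A ⊞ B) → IsZero A ∨ IsZero B

/-- A generator-cogenerator: `add M` contains the regular module and all
finitely generated injective modules. -/
def IsGenCogen (M : ModuleCat.{u} Λ) : Prop :=
  InAdd Λ M (ModuleCat.of Λ Λ) ∧
  ∀ I : ModuleCat.{u} Λ, Module.Finite Λ I → Injective I → InAdd Λ M I

/-- `g : A ⟶ X` is a right minimal `add M`-approximation. -/
def IsRMApprox (M : ModuleCat.{u} Λ) {A X : ModuleCat.{u} Λ} (g : A ⟶ X) : Prop :=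
  InAdd Λ M A ∧
  (∀ T : ModuleCat.{u} Λ, InAdd Λ M T → ∀ f : T ⟶ X, ∃ h : T ⟶ A, h ≫ g = f) ∧
  (∀ h : A ⟶ A, h ≫ g = g → IsIso h)

/-- `IsMSyzygy M X r W` : `W` is an `r`-th `M`-syzygy `Ω_M^r(X)` of `X`. -/
inductive IsMSyzygy (M : ModuleCat.{u} Λ) : ModuleCat.{u} Λ → ℕ → ModuleCat.{u} Λ → Prop
  | zero (X : ModuleCat.{u} Λ) : IsMSyzygy M X 0 X
  | succ (X : ModuleCat.{u} Λ) (r : ℕ) (W A : ModuleCat.{u} Λ) (g : A ⟶ W)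
      (hW : IsMSyzygy M X r W) (hg : IsRMApprox Λ M g) :
      IsMSyzygy M X (r + 1) (kernel g)

/-- The `M`-dimension of `X` is at most `r`. -/
def MdimLE (M X : ModuleCat.{u} Λ) (r : ℕ) : Prop :=
  ∃ W : ModuleCat.{u} Λ, IsMSyzygy Λ M X r W ∧ InAdd Λ M W

/-- projective dimension at most `r`, via a length `r` projective resolution. -/
def ProjDimLE (A : Type u) [Ring A] (N : ModuleCat.{u} A) (r : ℕ) : Prop :=
  ∃ (P : ℕ → ModuleCat.{u} A) (d : ∀ i : ℕ, P (i + 1) ⟶ P i) (f : P 0 ⟶ N),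
    (∀ i, Projective (P i)) ∧ (∀ i, r < i → IsZero (P i)) ∧ Epi f ∧
    (∃ w : d 0 ≫ f = 0, (ShortComplex.mk (d 0) f w).Exact) ∧
    (∀ i, ∃ w : d (i + 1) ≫ d i = 0, (ShortComplex.mk (d (i + 1)) (d i) w).Exact)

/-- global dimension at most `r`. -/
def GldimLE (A : Type u) [Ring A] (r : ℕ) : Prop :=
  ∀ N : ModuleCat.{u} A, ProjDimLE A N r

/-- the global dimension, as an element of `ℕ∞`. -/
noncomputable def gldim (A : Type u) [Ring A] : ℕ∞ :=
  sInf {c : ℕ∞ | ∃ r : ℕ, c = (r : ℕ∞) ∧ GldimLE A r}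

/-- dominant dimension at least `r`: there is an exact sequence
`0 → A → I^0 → ⋯ → I^(r-1)` with all `I^i` projective-injective. -/
def DomdimGE (A : Type u) [Ring A] (r : ℕ) : Prop :=
  ∃ (I : ℕ → ModuleCat.{u} A) (f : ModuleCat.of A A ⟶ I 0) (g : ∀ i : ℕ, I i ⟶ I (i + 1)),
    Mono f ∧ (∀ i, i < r → Injective (I i) ∧ Projective (I i)) ∧
    (2 ≤ r → ∃ w : f ≫ g 0 = 0, (ShortComplex.mk f (g 0) w).Exact) ∧
    (∀ i, i + 3 ≤ r → ∃ w : g i ≫ g (i + 1) = 0, (ShortComplex.mk (g i) (g (i + 1)) w).Exact)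

/-- the dominant dimension, as an element of `ℕ∞`. -/
noncomputable def domdim (A : Type u) [Ring A] : ℕ∞ :=
  sSup {c : ℕ∞ | ∃ r : ℕ, c = (r : ℕ∞) ∧ DomdimGE A r}

/-- the rigidity degree of a module, as an element of `ℕ∞`. -/
noncomputable def rigDeg [HasExt.{u} (ModuleCat.{u} Λ)] (M : ModuleCat.{u} Λ) : ℕ∞ :=
  sSup {c : ℕ∞ | ∃ r : ℕ, c = (r : ℕ∞) ∧ 0 < r ∧
    ∀ i : ℕ, 1 ≤ i → i ≤ r → Subsingleton (Abelian.Ext M M i)}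

/-- the rigidity dimension. -/
noncomputable def rigdim : ℕ∞ :=
  sSup {c : ℕ∞ | ∃ M : ModuleCat.{u} Λ, Module.Finite Λ M ∧ IsGenCogen Λ M ∧
    (∃ r : ℕ, GldimLE (End (op M)) r) ∧ c = domdim (End (op M))}

/-- An Auslander-Reiten (almost split) sequence. -/
def IsARSeq {X Y Z : ModuleCat.{u} Λ} (f : X ⟶ Y) (g : Y ⟶ Z) : Prop :=
  Mono f ∧ Epi g ∧ (∃ w : f ≫ g = 0, (ShortComplex.mk f g w).Exact) ∧
  Indec Λ X ∧ Indec Λ Z ∧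
  (¬ ∃ s : Z ⟶ Y, s ≫ g = 𝟙 Z) ∧
  (∀ (W : ModuleCat.{u} Λ) (h : W ⟶ Z), (¬ ∃ s : Z ⟶ W, s ≫ h = 𝟙 Z) →
    ∃ h' : W ⟶ Y, h' ≫ g = h)

/-- `X` has composition length `t`. -/
def HasCompLength (X : ModuleCat.{u} Λ) (t : ℕ) : Prop :=
  (∃ c : Fin (t + 1) → Submodule Λ X, StrictMono c ∧ c 0 = ⊥ ∧ c (Fin.last t) = ⊤) ∧
  ∀ r : ℕ, (∃ c : Fin (r + 1) → Submodule Λ X, StrictMono c ∧ c 0 = ⊥ ∧ c (Fin.last r) = ⊤) →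
    r ≤ t


section SelfInjective

variable {R : Type u} [Ring R]

/-- Over an artinian ring, finitely many elements taken from a family of simple modules already
have the annihilator of the whole family; hence only finitely many of the modules are needed to
realise every simple module killed by that annihilator. -/
lemma exists_finite_simple_realization [IsArtinianRing R] {ι : Type*} (S : ι → Type*)
    [∀ i, AddCommGroup (S i)] [∀ i, Module R (S i)] [∀ i, IsSimpleModule R (S i)] :
    ∃ t : Set ι, t.Finite ∧ ∀ (U : Type u) [AddCommGroup U] [Module R U] [IsSimpleModule R U],
      (∀ a : R, (∀ i, ∀ s : S i, a • s = 0) → ∀ x : U, a • x = 0) →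
        ∃ i ∈ t, Nonempty (U ≃ₗ[R] S i) := by
  classical
  let K : (Σ i, S i) → Submodule R R := fun p => LinearMap.ker (LinearMap.toSpanSingleton R _ p.2)
  obtain ⟨_, ⟨F, rfl⟩, hF⟩ := IsArtinian.set_has_minimal
    (Set.range fun F : Finset (Σ i, S i) => F.inf K) ⟨_, ⟨∅, rfl⟩⟩
  have hle : ∀ p, F.inf K ≤ K p := by
    intro p
    have h1 : (insert p F).inf K ≤ F.inf K := Finset.inf_mono (Finset.subset_insert _ _)
    have h2 := hF _ ⟨insert p F, rfl⟩
    have h3 : (insert p F).inf K = F.inf K := by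
      by_contra h
      exact h2 (lt_of_le_of_ne h1 h)
    rw [← h3]
    exact Finset.inf_le (Finset.mem_insert_self _ _)
  refine ⟨Sigma.fst '' (F : Set (Σ i, S i)), F.finite_toSet.image _, ?_⟩
  intro U _ _ _ hU
  let φ : R →ₗ[R] (∀ p : F, S p.1.1) := LinearMap.pi fun p => LinearMap.toSpanSingleton R _ p.1.2
  have := IsSimpleModule.nontrivial R U
  obtain ⟨u, hu⟩ := exists_ne (0 : U)
  let ψ : R →ₗ[R] U := LinearMap.toSpanSingleton R U u
  have hψ : Function.Surjective ψ := by
    have := LinearMap.surjective_or_eq_zero ψ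
    refine this.resolve_right fun h => hu ?_
    have := LinearMap.congr_fun h 1
    simpa [ψ] using this
  have hker : LinearMap.ker φ ≤ LinearMap.ker ψ := by
    intro a ha
    have ha' : ∀ p, a ∈ K p := by
      intro p
      refine hle p ?_
      rw [Submodule.mem_finsetInf]
      intro q hq
      have := congr_fun (LinearMap.mem_ker.1 ha) ⟨q, hq⟩
      simpa [φ, K] using this
    have := hU a (fun i s => by simpa [K] using ha' ⟨i, s⟩) u
    simpa [ψ] using this
  let e := φ.quotKerEquivRange
  let g : LinearMap.range φ →ₗ[R] U := (LinearMap.ker φ).liftQ ψ hker ∘ₗ e.symm.toLinearMap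
  have hg : Function.Surjective g := by
    intro x
    obtain ⟨a, ha⟩ := hψ x
    refine ⟨e (Submodule.Quotient.mk a), ?_⟩
    simp [g, ha]
  have : IsSemisimpleModule R (∀ p : F, S p.1.1) := inferInstance
  obtain ⟨h, hh⟩ := IsSemisimpleModule.lifting_property g hg LinearMap.id
  have hne : (h u : ∀ p : F, S p.1.1) ≠ 0 := by
    intro h0
    have h0' : h u = 0 := Subtype.ext h0
    have := LinearMap.congr_fun hh u
    simp [h0'] at this
    exact hu this.symm
  obtain ⟨p, hp⟩ := Function.ne_iff.1 hne
  let f : U →ₗ[R] S p.1.1 := LinearMap.proj p ∘ₗ (LinearMap.range φ).subtype ∘ₗ h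
  have hf : f ≠ 0 := fun h0 => hp (by simpa [f] using LinearMap.congr_fun h0 u)
  exact ⟨p.1.1, ⟨p.1, p.2, rfl⟩, ⟨LinearEquiv.ofBijective f
    ((LinearMap.bijective_or_eq_zero f).resolve_right hf)⟩⟩

/-- In a left self-injective ring a proper two-sided ideal that is finitely generated on the right
has a nonzero left annihilator. -/
lemma exists_ne_zero_mul_eq_zero [Module.Injective R R] (I : Ideal R) [I.IsTwoSided] (hI : I ≠ ⊤)
    {n : ℕ} (x : Fin n → R) (hx : ∀ i, x i ∈ I)
    (hgen : ∀ a : R, (∀ i, a * x i = 0) → ∀ y ∈ I, a * y = 0) :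
    ∃ a : R, a ≠ 0 ∧ ∀ y ∈ I, a * y = 0 := by
  by_contra! hcon
  let φ : R →ₗ[R] (Fin n → R) := LinearMap.pi fun i => LinearMap.toSpanSingleton R R (x i)
  have hφ : Function.Injective φ := by
    rw [← LinearMap.ker_eq_bot, LinearMap.ker_eq_bot']
    intro a ha
    by_contra hne
    obtain ⟨y, hy, hay⟩ := hcon a hne
    exact hay (hgen a (fun i => by simpa [φ] using congr_fun ha i) y hy)
  obtain ⟨ψ, hψ⟩ := Module.Injective.extension_property R R _ _ φ hφ LinearMap.id
  have h1 : ψ (φ 1) = 1 := LinearMap.congr_fun hψ 1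
  apply hI
  rw [Ideal.eq_top_iff_one, ← h1]
  have : φ 1 = ∑ i, x i • Pi.single i (1 : R) := by
    ext j
    simp [φ, Finset.sum_apply, Pi.single_apply]
  rw [this, map_sum]
  refine Ideal.sum_mem _ fun i _ => ?_
  rw [map_smul, smul_eq_mul]
  exact I.mul_mem_right _ (hx i)

lemma nonempty_linearEquiv_of_annihilator_le [IsArtinianRing R] {S U : Type u}
    [AddCommGroup S] [Module R S] [IsSimpleModule R S]
    [AddCommGroup U] [Module R U] [IsSimpleModule R U]
    (h : Module.annihilator R S ≤ Module.annihilator R U) : Nonempty (U ≃ₗ[R] S) := by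
  obtain ⟨_, _, ht⟩ := exists_finite_simple_realization (R := R) (fun _ : Unit => S)
  obtain ⟨_, _, e⟩ := ht U fun a ha =>
    Module.mem_annihilator.1 (h (Module.mem_annihilator.2 fun s => ha () s))
  exact e

variable (R) in
/-- The setoid on maximal left ideals identifying those with isomorphic simple quotients. -/
def simpleSetoid : Setoid {m : Ideal R // m.IsMaximal} where
  r m m' := Nonempty ((R ⧸ m.1) ≃ₗ[R] (R ⧸ m'.1))
  iseqv := ⟨fun _ => ⟨LinearEquiv.refl _ _⟩, fun ⟨e⟩ => ⟨e.symm⟩, fun ⟨e⟩ ⟨e'⟩ => ⟨e.trans e'⟩⟩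

lemma isSimpleModule_quotient (m : Ideal R) (hm : m.IsMaximal) : IsSimpleModule R (R ⧸ m) :=
  isSimpleModule_iff_quot_maximal.2 ⟨m, hm, ⟨LinearEquiv.refl _ _⟩⟩

lemma finite_simple_classes [IsArtinianRing R] : Finite (Quotient (simpleSetoid R)) := by
  have inst (m : {m : Ideal R // m.IsMaximal}) := isSimpleModule_quotient m.1 m.2
  obtain ⟨t, ht, h⟩ := exists_finite_simple_realization (R := R)
    (fun m : {m : Ideal R // m.IsMaximal} => R ⧸ m.1)
  have := ht.to_subtype
  refine Finite.of_surjective (fun m : t => Quotient.mk (simpleSetoid R) m.1) fun q => ?_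
  induction q using Quotient.inductionOn with | _ m => ?_
  obtain ⟨i, hi, ⟨e⟩⟩ := h (R ⧸ m.1) fun a ha => ha m
  exact ⟨⟨i, hi⟩, Quotient.sound ⟨e.symm⟩⟩

lemma exists_simple_right_annihilated (k : Type*) [Field k] [Algebra k R] [FiniteDimensional k R]
    [IsArtinianRing R] [Module.Injective R R] (m : Ideal R) (hm : m.IsMaximal) :
    ∃ m' : {m : Ideal R // m.IsMaximal}, ∃ f : (R ⧸ m'.1) →ₗ[R] R, Function.Injective f ∧
      ∀ z, ∀ a ∈ Module.annihilator R (R ⧸ m), f z * a = 0 := by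
  have := isSimpleModule_quotient m hm
  have hnt := IsSimpleModule.nontrivial R (R ⧸ m)
  set I := Module.annihilator R (R ⧸ m) with hI
  have hItop : I ≠ ⊤ := by
    intro h
    obtain ⟨u, hu⟩ := exists_ne (0 : R ⧸ m)
    have h1 : (1 : R) ∈ I := h ▸ Submodule.mem_top
    exact hu (by simpa using Module.mem_annihilator.1 h1 u)
  obtain ⟨n, x, hx⟩ := Submodule.fg_iff_exists_fin_generating_family.1
    (IsNoetherian.noetherian (I.restrictScalars k))
  obtain ⟨a, ha, haI⟩ := exists_ne_zero_mul_eq_zero I hItop x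
    (fun i => by
      have : x i ∈ I.restrictScalars k := hx ▸ Submodule.subset_span ⟨i, rfl⟩
      exact this)
    (fun a ha y hy => by
      have hy' : y ∈ Submodule.span k (Set.range x) := hx ▸ hy
      clear hy
      induction hy' using Submodule.span_induction with
      | mem y hy => obtain ⟨i, rfl⟩ := hy; exact ha i
      | zero => simp
      | add y z _ _ hy hz =>
        rw [mul_add, hy, hz, add_zero]
      | smul c y _ hy =>
        rw [mul_smul_comm, hy, smul_zero])
  let K : Submodule R R :=
    { carrier := {a | ∀ y ∈ I, a * y = 0}
      add_mem' := fun ha hb y hy => by rw [add_mul, ha y hy, hb y hy, add_zero]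
      zero_mem' := fun y _ => zero_mul y
      smul_mem' := fun c a ha y hy => by rw [smul_eq_mul, mul_assoc, ha y hy, mul_zero] }
  have hK : K ≠ ⊥ := fun h => ha ((Submodule.mem_bot R).1 (h ▸ (haI : a ∈ K)))
  obtain ⟨T, hT, hTK⟩ := (IsAtomic.eq_bot_or_exists_atom_le K).resolve_left hK
  have hTs := isSimpleModule_iff_isAtom.2 hT
  obtain ⟨m', hm', ⟨e⟩⟩ := isSimpleModule_iff_quot_maximal.1 hTs
  refine ⟨⟨m', hm'⟩, T.subtype ∘ₗ e.symm.toLinearMap,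
    T.injective_subtype.comp e.symm.injective, fun z a ha => ?_⟩
  exact hTK (e.symm z).2 a ha

lemma nonempty_linearEquiv_of_mul_eq_zero [IsArtinianRing R] {m m' : Ideal R}
    (hm : m.IsMaximal) (hm' : m'.IsMaximal) {y : R} (hy : y ≠ 0)
    (h : ∀ a ∈ Module.annihilator R (R ⧸ m), y * a = 0)
    (h' : ∀ a ∈ Module.annihilator R (R ⧸ m'), y * a = 0) :
    Nonempty ((R ⧸ m) ≃ₗ[R] (R ⧸ m')) := by
  have hsup : Module.annihilator R (R ⧸ m) ⊔ Module.annihilator R (R ⧸ m') ≠ ⊤ := by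
    intro htop
    obtain ⟨a, ha, b, hb, hab⟩ := Submodule.mem_sup.1
      (htop ▸ Submodule.mem_top : (1 : R) ∈ Module.annihilator R (R ⧸ m) ⊔
        Module.annihilator R (R ⧸ m'))
    apply hy
    rw [← mul_one y, ← hab, mul_add, h a ha, h' b hb, add_zero]
  obtain ⟨n, hn, hle⟩ := Ideal.exists_le_maximal _ hsup
  have hns := isSimpleModule_quotient n hn
  have key : ∀ p : Ideal R, p.IsMaximal → Module.annihilator R (R ⧸ p) ≤ n →
      Nonempty ((R ⧸ n) ≃ₗ[R] (R ⧸ p)) := by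
    intro p hpm hp
    have := isSimpleModule_quotient p hpm
    refine nonempty_linearEquiv_of_annihilator_le fun a ha => Module.mem_annihilator.2 fun z => ?_
    obtain ⟨z, rfl⟩ := Submodule.Quotient.mk_surjective _ z
    rw [← Submodule.Quotient.mk_smul, Submodule.Quotient.mk_eq_zero]
    exact hp (Ideal.mul_mem_right _ _ ha)
  obtain ⟨e₁⟩ := key m hm (le_sup_left.trans hle)
  obtain ⟨e₂⟩ := key m' hm' (le_sup_right.trans hle)
  exact ⟨e₁.symm.trans e₂⟩

lemma exists_rel_of_reflects {α : Type*} (s : Setoid α) [Finite (Quotient s)] (T : α → α)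
    (h : ∀ a b, s (T a) (T b) → s a b) (a : α) : ∃ b, s (T b) a := by
  have hσ : Function.Injective fun q : Quotient s => Quotient.mk s (T q.out) := by
    intro q q' hqq
    rw [← Quotient.out_eq q, ← Quotient.out_eq q']
    exact Quotient.sound (h _ _ (Quotient.exact hqq))
  obtain ⟨q, hq⟩ := Finite.injective_iff_surjective.1 hσ (Quotient.mk _ a)
  exact ⟨q.out, Quotient.exact hq⟩

/-- Over a finite dimensional left self-injective algebra every simple module embeds into the
regular module. -/
lemma exists_simple_embedding (k : Type*) [Field k] [Algebra k R] [FiniteDimensional k R]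
    [IsArtinianRing R] [Module.Injective R R] (m : Ideal R) (hm : m.IsMaximal) :
    ∃ f : (R ⧸ m) →ₗ[R] R, Function.Injective f := by
  have := finite_simple_classes (R := R)
  choose T f hf hfa using fun m : {m : Ideal R // m.IsMaximal} =>
    exists_simple_right_annihilated k m.1 m.2
  obtain ⟨m', ⟨e⟩⟩ := exists_rel_of_reflects (simpleSetoid R) T (fun p q ⟨e⟩ => by
    obtain ⟨ψ, hψ⟩ := Module.Injective.extension_property R R _ _ (f p) (hf p)
      (f q ∘ₗ e.toLinearMap)
    have hs := isSimpleModule_quotient (T p).1 (T p).2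
    have hnt := IsSimpleModule.nontrivial R (R ⧸ (T p).1)
    obtain ⟨x, hx⟩ := exists_ne (0 : R ⧸ (T p).1)
    have hne : f q (e x) ≠ 0 := by
      rw [Ne, map_eq_zero_iff _ (hf _), map_eq_zero_iff _ e.injective]
      exact hx
    have h1 : ∀ a ∈ Module.annihilator R (R ⧸ p.1), f q (e x) * a = 0 := by
      intro a ha
      have h2 : f q (e x) = f p x * ψ 1 := by
        rw [← smul_eq_mul, ← map_smul, smul_eq_mul, mul_one]
        exact (LinearMap.congr_fun hψ x).symm
      rw [h2, mul_assoc]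
      exact hfa _ _ _ (Ideal.mul_mem_left _ _ ha)
    exact nonempty_linearEquiv_of_mul_eq_zero p.2 q.2 hne h1 (hfa _ _)) ⟨m, hm⟩
  refine ⟨(f m').comp e.symm.toLinearMap, ?_⟩
  rw [LinearMap.coe_comp]
  exact (hf m').comp (LinearEquiv.injective e.symm)

lemma exists_linearMap_self_apply_ne_zero (k : Type*) [Field k] [Algebra k R]
    [FiniteDimensional k R] [IsArtinianRing R] [Module.Injective R R] {X : Type u}
    [AddCommGroup X] [Module R X] {x : X} (hx : x ≠ 0) : ∃ f : X →ₗ[R] R, f x ≠ 0 := by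
  let ψ := LinearMap.toSpanSingleton R X x
  have hker : LinearMap.ker ψ ≠ ⊤ := by
    intro h
    have : (1 : R) ∈ LinearMap.ker ψ := h ▸ Submodule.mem_top
    exact hx (by simpa [ψ] using this)
  obtain ⟨m, hm, hle⟩ := Ideal.exists_le_maximal _ hker
  obtain ⟨f, hf⟩ := exists_simple_embedding k m hm
  let ι := (LinearMap.ker ψ).liftQ ψ le_rfl
  have hι : Function.Injective ι := LinearMap.ker_eq_bot.1 (Submodule.ker_liftQ_eq_bot _ _ _ le_rfl)
  obtain ⟨g, hg⟩ := Module.Injective.extension_property R R _ _ ι hι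
    (f ∘ₗ (LinearMap.ker ψ).liftQ (Submodule.mkQ m) (by rwa [Submodule.ker_mkQ]))
  refine ⟨g, ?_⟩
  have h1 := LinearMap.congr_fun hg (Submodule.Quotient.mk (1 : R))
  have h2 : ι (Submodule.Quotient.mk (1 : R)) = x := by simp [ι, ψ]
  rw [LinearMap.comp_apply, h2] at h1
  rw [h1]
  simp only [LinearMap.comp_apply, Submodule.liftQ_apply, Submodule.mkQ_apply]
  rw [Ne, map_eq_zero_iff _ hf, Submodule.Quotient.mk_eq_zero]
  exact fun h => hm.ne_top ((Ideal.eq_top_iff_one _).2 h)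

/-- Free modules over a noetherian self-injective ring are injective. -/
lemma injective_finsupp [IsNoetherianRing R] [Module.Injective R R] (J : Type u) :
    Module.Injective R (J →₀ R) := by
  classical
  refine Module.Baer.injective fun I g => ?_
  obtain ⟨s, hs⟩ := IsNoetherian.noetherian I
  let t : Finset J := s.attach.biUnion fun x => (g ⟨x.1, hs ▸ Submodule.subset_span x.2⟩).support
  have ht : ∀ x : I, ∀ j ∉ t, g x j = 0 := by
    rintro ⟨x, hx⟩ j hj
    have hx' : x ∈ Submodule.span R (s : Set R) := hs ▸ hx
    induction hx' using Submodule.span_induction with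
    | mem x hxs =>
      by_contra h
      exact hj (Finset.mem_biUnion.2 ⟨⟨x, hxs⟩, Finset.mem_attach _ _, Finsupp.mem_support_iff.2 h⟩)
    | zero => exact DFunLike.congr_fun (map_zero g) j
    | add x y hxs hys hx' hy' =>
      have := map_add g ⟨x, hs ▸ hxs⟩ ⟨y, hs ▸ hys⟩
      exact (DFunLike.congr_fun this j).trans (by simp [hx', hy'])
    | smul c x hxs hx' =>
      have := map_smul g c ⟨x, hs ▸ hxs⟩
      exact (DFunLike.congr_fun this j).trans (by simp [hx'])
  choose e he using fun j : J => Module.Injective.extension_property R R _ _ I.subtype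
    I.injective_subtype (Finsupp.lapply j ∘ₗ g)
  refine ⟨∑ j ∈ t, Finsupp.lsingle j ∘ₗ e j, fun x hx => ?_⟩
  have he' : ∀ j, e j x = g ⟨x, hx⟩ j := fun j => LinearMap.congr_fun (he j) ⟨x, hx⟩
  ext j
  simp only [LinearMap.sum_apply, LinearMap.comp_apply, Finsupp.lsingle_apply, he',
    Finsupp.finsetSum_apply, Finsupp.single_apply, Finset.sum_ite_eq']
  split_ifs with h
  · rfl
  · exact (ht _ _ h).symm

/-- Products of copies of the regular module of a finite dimensional algebra are projective. -/
lemma projective_pi_self (k : Type*) [Field k] [Algebra k R] [FiniteDimensional k R]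
    (J : Type*) : Module.Projective R (J → R) := by
  let b := Module.finBasis k R
  let v := Module.Free.chooseBasis k (J → k)
  let w : Module.Free.ChooseBasisIndex k (J → k) → (J → R) := fun t j => algebraMap k R (v t j)
  have key : ∀ (l : Module.Free.ChooseBasisIndex k (J → k) →₀ R) (j : J) (i),
      b.repr (Finsupp.linearCombination R w l j) i =
        Finsupp.linearCombination k v (l.mapRange (fun r => b.repr r i) (by simp)) j := by
    intro l j i
    rw [Finsupp.linearCombination_apply, Finsupp.linearCombination_apply,
      Finsupp.sum_mapRange_index (by simp), Finsupp.sum, Finsupp.sum, Finset.sum_apply,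
      Finset.sum_apply, map_sum, Finsupp.finsetSum_apply]
    refine Finset.sum_congr rfl fun t _ => ?_
    simp only [Pi.smul_apply, w, smul_eq_mul]
    rw [← Algebra.commutes, ← Algebra.smul_def, map_smul, Finsupp.smul_apply, smul_eq_mul, mul_comm]
  have hbij : Function.Bijective (Finsupp.linearCombination R w) := by
    constructor
    · rw [← LinearMap.ker_eq_bot, LinearMap.ker_eq_bot']
      intro l hl
      ext t
      apply b.repr.injective
      ext i
      have h : Finsupp.linearCombination k v (l.mapRange (fun r => b.repr r i) (by simp)) = 0 := by
        ext j
        rw [← key, hl]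
        simp
      have := DFunLike.congr_fun (v.linearIndependent (h.trans (map_zero _).symm)) t
      simpa using this
    · intro f
      let c : Fin _ → (J → k) := fun i j => b.repr (f j) i
      let l : Module.Free.ChooseBasisIndex k (J → k) →₀ R :=
        ∑ i, (v.repr (c i)).mapRange (fun x => x • b i) (by simp)
      refine ⟨l, ?_⟩
      ext j
      apply b.repr.injective
      ext i
      rw [key]
      have : l.mapRange (fun r => b.repr r i) (by simp) = v.repr (c i) := by
        ext t
        simp [l, Finsupp.finsetSum_apply, Finsupp.single_apply]
      rw [this, v.linearCombination_repr]
  exact Module.Projective.of_equiv (LinearEquiv.ofBijective _ hbij)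

theorem module_projective_iff_injective (k : Type*) [Field k] [Algebra k R]
    [FiniteDimensional k R] [Module.Injective R R] (X : Type u) [AddCommGroup X] [Module R X] :
    Module.Projective R X ↔ Module.Injective R X := by
  have : IsArtinianRing R := IsArtinianRing.of_finite k R
  constructor
  · intro hX
    obtain ⟨s, hs⟩ := hX.out
    have := injective_finsupp (R := R) X
    refine ⟨fun A B _ _ _ _ i hi g => ?_⟩
    obtain ⟨h, hh⟩ := Module.Injective.out i hi (s ∘ₗ g)
    exact ⟨Finsupp.linearCombination R id ∘ₗ h, fun a => by simp [hh, hs (g a)]⟩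
  · intro hX
    have := projective_pi_self (R := R) k (X →ₗ[R] R)
    let i : X →ₗ[R] ((X →ₗ[R] R) → R) := LinearMap.pi fun f => f
    have hi : Function.Injective i := by
      rw [← LinearMap.ker_eq_bot, LinearMap.ker_eq_bot']
      intro x hx
      by_contra h
      obtain ⟨f, hf⟩ := exists_linearMap_self_apply_ne_zero (R := R) k h
      exact hf (congr_fun hx f)
    obtain ⟨r, hr⟩ := Module.Injective.extension_property R X _ _ i hi LinearMap.id
    exact Module.Projective.of_split i r hr

end SelfInjective

section StableRetract

open scoped ZeroObject

universe v w

variable {C : Type w} [Category.{v} C] [Abelian C]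

/-- `X` is a retract of the direct sum of `X'` and a projective object. -/
def StableRetract (X X' : C) : Prop :=
  ∃ (Q : C) (i : X ⟶ X') (r : X' ⟶ X) (a : X ⟶ Q) (b : Q ⟶ X),
    Projective Q ∧ i ≫ r + a ≫ b = 𝟙 X

lemma StableRetract.refl (X : C) : StableRetract X X :=
  ⟨0, 𝟙 X, 𝟙 X, 0, 0, inferInstance, by simp⟩

lemma StableRetract.of_projective (X X' : C) [Projective X] : StableRetract X X' :=
  ⟨X, 0, 0, 𝟙 X, 𝟙 X, inferInstance, by simp⟩

lemma StableRetract.of_retract {X X' : C} (h : Retract X X') : StableRetract X X' :=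
  ⟨0, h.i, h.r, 0, 0, inferInstance, by simp⟩

lemma StableRetract.trans {X Y Z : C} (h : StableRetract X Y) (h' : StableRetract Y Z) :
    StableRetract X Z := by
  obtain ⟨Q, i, r, a, b, hQ, e⟩ := h
  obtain ⟨Q', i', r', a', b', hQ', e'⟩ := h'
  refine ⟨Q ⊞ Q', i ≫ i', r' ≫ r, biprod.lift a (i ≫ a'), biprod.desc b (b' ≫ r),
    inferInstance, ?_⟩
  rw [biprod.lift_desc, ← e, add_comm (a ≫ b), ← add_assoc]
  congr 1
  simp only [Category.assoc, ← Preadditive.comp_add]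
  rw [← Category.assoc i' r', ← Category.assoc a' b', ← Preadditive.add_comp, e',
    Category.id_comp]

lemma StableRetract.map {X X' : C} (h : StableRetract X X') (F : C ⥤ C) [F.Additive]
    (hF : ∀ P : C, Projective P → Projective (F.obj P)) :
    StableRetract (F.obj X) (F.obj X') := by
  obtain ⟨Q, i, r, a, b, hQ, e⟩ := h
  exact ⟨F.obj Q, F.map i, F.map r, F.map a, F.map b, hF _ hQ, by
    rw [← F.map_comp, ← F.map_comp, ← F.map_add, e, F.map_id]⟩

/-- Stable retracts are inherited by syzygies. -/
lemma StableRetract.syzygy {S S' : ShortComplex C} (hS : S.ShortExact) (hS' : S'.ShortExact)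
    [Projective S.X₂] [Projective S'.X₂] (h : StableRetract S.X₃ S'.X₃) :
    StableRetract S.X₁ S'.X₁ := by
  have := hS.epi_g; have := hS'.epi_g; have := hS.mono_f; have := hS'.mono_f
  obtain ⟨Q, i, r, a, b, hQ, e⟩ := h
  let b' := Projective.factorThru b S.g
  have hb' : b' ≫ S.g = b := Projective.factorThru_comp _ _
  let i₂ := Projective.factorThru (S.g ≫ i) S'.g
  have hi₂ : i₂ ≫ S'.g = S.g ≫ i := Projective.factorThru_comp _ _
  let r₂ := Projective.factorThru (S'.g ≫ r) S.g
  have hr₂ : r₂ ≫ S.g = S'.g ≫ r := Projective.factorThru_comp _ _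
  have hi : (S.f ≫ i₂) ≫ S'.g = 0 := by simp [hi₂]
  have hr : (S'.f ≫ r₂) ≫ S.g = 0 := by simp [hr₂]
  have ht : (𝟙 S.X₂ - i₂ ≫ r₂ - S.g ≫ a ≫ b') ≫ S.g = 0 := by
    simp only [Preadditive.sub_comp, Category.assoc, hr₂, hb', reassoc_of% hi₂, Category.id_comp]
    rw [sub_sub, ← Preadditive.comp_add, e]; simp
  refine ⟨S.X₂, hS'.exact.lift _ hi, hS.exact.lift _ hr, S.f, hS.exact.lift _ ht,
    inferInstance, ?_⟩
  rw [← cancel_mono S.f]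
  simp only [Preadditive.add_comp, Category.assoc, ShortComplex.Exact.lift_f]
  rw [← Category.assoc, hS'.exact.lift_f]
  simp

/-- Stable retracts are inherited by cosyzygies. -/
lemma StableRetract.cosyzygy (hPI : ∀ X : C, Projective X ↔ Injective X)
    {S S' : ShortComplex C} (hS : S.ShortExact) (hS' : S'.ShortExact)
    [Projective S.X₂] [Projective S'.X₂] (h : StableRetract S.X₁ S'.X₁) :
    StableRetract S.X₃ S'.X₃ := by
  have := hS.epi_g; have := hS'.epi_g; have := hS.mono_f; have := hS'.mono_f
  obtain ⟨Q, i, r, a, b, hQ, e⟩ := h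
  have := (hPI _).1 hQ
  have := (hPI S.X₂).1 inferInstance
  have := (hPI S'.X₂).1 inferInstance
  let a' := Injective.factorThru a S.f
  have ha' : S.f ≫ a' = a := Injective.comp_factorThru _ _
  let i₂ := Injective.factorThru (i ≫ S'.f) S.f
  have hi₂ : S.f ≫ i₂ = i ≫ S'.f := Injective.comp_factorThru _ _
  let r₂ := Injective.factorThru (r ≫ S.f) S'.f
  have hr₂ : S'.f ≫ r₂ = r ≫ S.f := Injective.comp_factorThru _ _
  have hi : S.f ≫ (i₂ ≫ S'.g) = 0 := by rw [reassoc_of% hi₂]; simp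
  have hr : S'.f ≫ (r₂ ≫ S.g) = 0 := by rw [reassoc_of% hr₂]; simp
  have ht : S.f ≫ (𝟙 S.X₂ - i₂ ≫ r₂ - a' ≫ b ≫ S.f) = 0 := by
    simp only [Preadditive.comp_sub, reassoc_of% ha', reassoc_of% hi₂, hr₂, Category.comp_id]
    rw [sub_sub, ← Category.assoc, ← Category.assoc, ← Preadditive.add_comp, e]; simp
  refine ⟨S.X₂, hS.exact.desc _ hi, hS'.exact.desc _ hr, hS.exact.desc _ ht, S.g,
    inferInstance, ?_⟩
  rw [← cancel_epi S.g]
  simp only [Preadditive.comp_add, ShortComplex.Exact.g_desc_assoc, Category.assoc,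
    ShortComplex.Exact.g_desc]
  simp

end StableRetract

section Copower

universe v w

variable {C : Type w} [Category.{v} C] [HasCoproducts.{v} C]

/-- The functor sending `X` to the coproduct of copies of `X` indexed by `I`. -/
noncomputable def copower (C : Type w) [Category.{v} C] [HasCoproducts.{v} C] (I : Type v) :
    C ⥤ C :=
  Functor.const (Discrete I) ⋙ colim

noncomputable def copower.ι {I : Type v} (X : C) (i : I) : X ⟶ (copower C I).obj X :=
  colimit.ι ((Functor.const (Discrete I)).obj X) ⟨i⟩

noncomputable def copower.desc {I : Type v} {X Y : C} (f : I → (X ⟶ Y)) :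
    (copower C I).obj X ⟶ Y :=
  colimit.desc ((Functor.const (Discrete I)).obj X)
    { pt := Y
      ι := Discrete.natTrans fun i => f i.as }

lemma copower.ι_desc {I : Type v} {X Y : C} (f : I → (X ⟶ Y)) (i : I) :
    copower.ι X i ≫ copower.desc f = f i :=
  colimit.ι_desc _ _

lemma copower.hom_ext {I : Type v} {X Y : C} {f g : (copower C I).obj X ⟶ Y}
    (h : ∀ i : I, copower.ι X i ≫ f = copower.ι X i ≫ g) : f = g :=
  colimit.hom_ext fun i => h i.as

lemma copower.ι_map {I : Type v} {X Y : C} (f : X ⟶ Y) (i : I) :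
    copower.ι X i ≫ (copower C I).map f = f ≫ copower.ι Y i := by
  simp [copower.ι, copower]

instance (I : Type v) (P : C) [Projective P] : Projective ((copower C I).obj P) where
  factors f e _ := ⟨copower.desc fun i => Projective.factorThru (copower.ι P i ≫ f) e,
    copower.hom_ext fun i => by rw [← Category.assoc, copower.ι_desc, Projective.factorThru_comp]⟩

variable [Abelian C]

instance (I : Type v) : (copower C I).Additive where
  map_add {X Y f g} := copower.hom_ext fun i => by
    rw [copower.ι_map, Preadditive.comp_add, copower.ι_map, copower.ι_map, Preadditive.add_comp]

lemma copower.map_shortExact [AB4 C] (I : Type v) {S : ShortComplex C} (hS : S.ShortExact) :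
    (S.map (copower C I)).ShortExact := by
  have : PreservesFiniteLimits (colim : (Discrete I ⥤ C) ⥤ C) := inferInstance
  have : PreservesFiniteLimits (copower C I) := by unfold copower; infer_instance
  have : PreservesFiniteColimits (copower C I) := by unfold copower; infer_instance
  exact hS.map_of_exact _

end Copower

section HomLike

universe v w w'

variable {C : Type w} [Category.{v} C] [Abelian C] [HasCoproducts.{v} C]
  {D : Type w'} [Category.{v} D] [Abelian D]

/-- The properties of the functor `Hom(G, -)` to modules over the endomorphism ring of `G`, where
`G` is the direct sum of a projective generator and `N`, that are used to compare homological
dimensions. -/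
structure HomLike (F : C ⥤ D) (N : C) : Prop where
  epi_map_iff {X Y : C} (f : X ⟶ Y) :
    Epi (F.map f) ↔ Epi f ∧ ∀ n : N ⟶ Y, ∃ m : N ⟶ X, m ≫ f = n
  projective_iff (X : C) :
    Projective (F.obj X) ↔ ∃ I : Type v, StableRetract X ((copower C I).obj N)
  exists_iso (Y : D) (hY : Projective Y) : ∃ X : C, Nonempty (F.obj X ≅ Y)

variable {F : C ⥤ D} [F.Additive] [PreservesFiniteLimits F] {N : C}

omit [HasCoproducts.{v} C] in
lemma map_exact_mono (F : C ⥤ D) [F.Additive] [PreservesFiniteLimits F]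
    {S : ShortComplex C} (hS : S.Exact) [Mono S.f] :
    (S.map F).Exact ∧ Mono (S.map F).f :=
  ⟨hS.map_of_mono_of_preservesKernel F inferInstance inferInstance,
    inferInstanceAs (Mono (F.map S.f))⟩

lemma HomLike.map_shortExact (hF : HomLike F N) {S : ShortComplex C} (hS : S.ShortExact)
    (h : ∀ n : N ⟶ S.X₃, ∃ m : N ⟶ S.X₂, m ≫ S.g = n) : (S.map F).ShortExact := by
  have := hS.mono_f
  obtain ⟨h₁, h₂⟩ := map_exact_mono F hS.exact
  exact { exact := h₁, mono_f := h₂, epi_g := (hF.epi_map_iff S.g).2 ⟨hS.epi_g, h⟩ }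

omit [HasCoproducts.{v} C] in
lemma shortExact_kernel {X Y : C} (f : X ⟶ Y) [Epi f] :
    (ShortComplex.mk (kernel.ι f) f (kernel.condition f)).ShortExact :=
  { exact := ShortComplex.exact_of_f_is_kernel _ (kernelIsKernel f) }

/-- Passing from `N` to its syzygy and from `X` to its syzygy preserves the projective dimension
of `Hom(G, X)`. -/
theorem HomLike.hasProjectiveDimensionLT_iff_syzygy [AB4 C] [EnoughProjectives C]
    (hPI : ∀ X : C, Projective X ↔ Injective X)
    {D' : Type w'} [Category.{v} D'] [Abelian D'] {F' : C ⥤ D'} [F'.Additive]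
    [PreservesFiniteLimits F'] {T : ShortComplex C} (hT : T.ShortExact) [Projective T.X₂]
    (hF : HomLike F T.X₃) (hF' : HomLike F' T.X₁) (s : ℕ) {S : ShortComplex C}
    (hS : S.ShortExact) [Projective S.X₂] :
    HasProjectiveDimensionLT (F.obj S.X₃) (s + 1) ↔
      HasProjectiveDimensionLT (F'.obj S.X₁) (s + 1) := by
  induction s generalizing S with
  | zero =>
    rw [zero_add, ← projective_iff_hasProjectiveDimensionLT_one,
      ← projective_iff_hasProjectiveDimensionLT_one, hF.projective_iff, hF'.projective_iff]
    refine exists_congr fun I => ?_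
    have : Projective (T.map (copower C I)).X₂ :=
      inferInstanceAs (Projective ((copower C I).obj T.X₂))
    exact ⟨fun h => StableRetract.syzygy hS (copower.map_shortExact I hT) h,
      fun h => StableRetract.cosyzygy hPI hS (copower.map_shortExact I hT) h⟩
  | succ s ih =>
    have := hS.epi_g; have := hS.mono_f; have := hT.epi_g; have := hT.mono_f
    let Q := (copower C (T.X₃ ⟶ S.X₃)).obj T.X₃
    let φ : Q ⟶ S.X₃ := copower.desc id
    let ψ : Q ⊞ S.X₂ ⟶ S.X₃ := biprod.desc φ S.g
    have hψ : Epi ψ := by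
      have : Epi (biprod.inr ≫ ψ) := by simpa [ψ] using hS.epi_g
      exact epi_of_epi biprod.inr ψ
    have h₁ := hF.map_shortExact (shortExact_kernel ψ) fun n =>
      ⟨copower.ι T.X₃ n ≫ biprod.inl, by simp [ψ, φ, copower.ι_desc]⟩
    have hQ : Projective (F.obj (Q ⊞ S.X₂)) := (hF.projective_iff _).2
      ⟨T.X₃ ⟶ S.X₃, S.X₂, biprod.fst, biprod.inl, biprod.snd, biprod.inr, inferInstance,
        biprod.total⟩
    let ρ : Projective.over (kernel ψ) ⟶ kernel ψ := Projective.π _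
    let σ : Projective.over (kernel ψ) ⟶ Q := ρ ≫ kernel.ι ψ ≫ biprod.fst
    let τ : Projective.over (kernel ψ) ⟶ S.X₂ := ρ ≫ kernel.ι ψ ≫ biprod.snd
    have hστ : σ ≫ φ + τ ≫ S.g = 0 := by
      have h : ψ = biprod.fst ≫ φ + biprod.snd ≫ S.g := by
        apply biprod.hom_ext' <;> simp [ψ]
      have h' : ρ ≫ kernel.ι ψ ≫ ψ = 0 := by simp
      have h'' := (ρ ≫ kernel.ι ψ) ≫= h
      simpa [h', σ, τ] using h''.symm
    have lift_ex {U : C} (q : U ⟶ Q) (y : U ⟶ S.X₂) (hqy : q ≫ φ + y ≫ S.g = 0) :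
        ∃ κ : U ⟶ kernel ψ, κ ≫ kernel.ι ψ ≫ biprod.fst = q ∧
          κ ≫ kernel.ι ψ ≫ biprod.snd = y :=
      ⟨kernel.lift ψ (biprod.lift q y) (by simpa [ψ] using hqy), by simp, by simp⟩
    have hσ : Epi σ := by
      rw [epi_iff_surjective_up_to_refinements]
      intro U q
      obtain ⟨U', a, ha, y, hy⟩ := surjective_up_to_refinements_of_epi S.g (q ≫ φ)
      obtain ⟨κ, hκ, -⟩ := lift_ex (a ≫ q) (-y) (by simp [hy])
      obtain ⟨U'', b, hb, z, hz⟩ := surjective_up_to_refinements_of_epi ρ κ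
      exact ⟨U'', b ≫ a, inferInstance, z, by
        rw [Category.assoc, ← hκ]; simp only [σ]; rw [reassoc_of% hz]⟩
    let w : kernel σ ⟶ S.X₁ := hS.exact.lift (kernel.ι σ ≫ τ) (by
      have := kernel.ι σ ≫= hστ
      simpa using this)
    have hw : w ≫ S.f = kernel.ι σ ≫ τ := hS.exact.lift_f _ _
    let j : kernel ρ ⟶ kernel σ := kernel.lift σ (kernel.ι ρ) (by simp [σ])
    have hj : j ≫ kernel.ι σ = kernel.ι ρ := kernel.lift_ι _ _ _
    have hjw : j ≫ w = 0 := by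
      rw [← cancel_mono S.f, Category.assoc, hw, reassoc_of% hj]
      simp [τ]
    have hW : (ShortComplex.mk j w hjw).ShortExact :=
      { exact := by
          rw [ShortComplex.exact_iff_exact_up_to_refinements]
          intro U x hx
          dsimp at x hx
          have hxρ : (x ≫ kernel.ι σ) ≫ ρ = 0 := by
            rw [← cancel_mono (kernel.ι ψ)]
            apply biprod.hom_ext
            · simp [σ]
            · have := hx =≫ S.f
              rw [Category.assoc, hw] at this
              simpa [τ] using this
          exact ⟨U, 𝟙 U, inferInstance, kernel.lift ρ _ hxρ, by
            rw [← cancel_mono (kernel.ι σ)]; simp [j]⟩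
        mono_f := by
          have : Mono (j ≫ kernel.ι σ) := by rw [hj]; infer_instance
          exact mono_of_mono j (kernel.ι σ)
        epi_g := by
          dsimp
          rw [epi_iff_surjective_up_to_refinements]
          intro U y
          obtain ⟨κ, hκ₁, hκ₂⟩ := lift_ex (0 : U ⟶ Q) (y ≫ S.f) (by simp)
          obtain ⟨U', b, hb, z, hz⟩ := surjective_up_to_refinements_of_epi ρ κ
          refine ⟨U', b, hb, kernel.lift σ z ?_, ?_⟩
          · simp only [σ]; rw [← reassoc_of% hz, hκ₁]; simp
          · rw [← cancel_mono S.f, Category.assoc, Category.assoc, hw, kernel.lift_ι_assoc]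
            simp only [τ]; rw [← reassoc_of% hz, hκ₂] }
    have h₂ := hF'.map_shortExact hW fun n => by
      have := (hPI S.X₂).1 inferInstance
      let e := Injective.factorThru (n ≫ S.f) T.f
      have he : T.f ≫ e = n ≫ S.f := Injective.comp_factorThru _ _
      let n' := hT.exact.desc (e ≫ S.g) (by rw [reassoc_of% he]; simp)
      have hn' : T.g ≫ n' = e ≫ S.g := hT.exact.g_desc _ _
      obtain ⟨κ, hκ₁, hκ₂⟩ := lift_ex (T.g ≫ copower.ι T.X₃ n') (-e) (by
        simp [φ, copower.ι_desc, hn'])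
      let l := Projective.factorThru κ ρ
      have hl : l ≫ ρ = κ := Projective.factorThru_comp _ _
      refine ⟨-kernel.lift σ (T.f ≫ l) ?_, ?_⟩
      · simp only [σ, Category.assoc]; rw [reassoc_of% hl, hκ₁]; simp
      · rw [← cancel_mono S.f]
        dsimp
        rw [Category.assoc, hw, Preadditive.neg_comp, kernel.lift_ι_assoc]
        simp only [τ, Category.assoc]; rw [reassoc_of% hl, hκ₂]; simp [he]
    have hW' : Projective (F'.obj (kernel σ)) := by
      refine (hF'.projective_iff _).2 ⟨T.X₃ ⟶ S.X₃, ?_⟩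
      have : Projective (T.map (copower C (T.X₃ ⟶ S.X₃))).X₂ :=
        inferInstanceAs (Projective ((copower C (T.X₃ ⟶ S.X₃)).obj T.X₂))
      have : Projective (ShortComplex.mk (kernel.ι σ) σ (kernel.condition σ)).X₂ :=
        inferInstanceAs (Projective (Projective.over (kernel ψ)))
      exact StableRetract.syzygy (shortExact_kernel σ) (copower.map_shortExact _ hT)
        (StableRetract.refl _)
    have : Projective (ShortComplex.mk (kernel.ι ρ) ρ (kernel.condition ρ)).X₂ :=
      inferInstanceAs (Projective (Projective.over (kernel ψ)))
    exact (h₁.hasProjectiveDimensionLT_X₃_iff s hQ).trans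
      ((ih (shortExact_kernel ρ)).trans (h₂.hasProjectiveDimensionLT_X₃_iff s hW').symm)

end HomLike

section GlobalDimension

universe v w w'

lemma hasProjectiveDimensionLT_cokernel_iff {D : Type w'} [Category.{v} D] [Abelian D]
    {S : ShortComplex D} (hS : S.Exact) [Mono S.f] (h₂ : Projective S.X₂) (h₃ : Projective S.X₃)
    (n : ℕ) : HasProjectiveDimensionLT (cokernel S.g) (n + 3) ↔
      HasProjectiveDimensionLT S.X₁ (n + 1) := by
  have h : (ShortComplex.mk S.f (Abelian.factorThruImage S.g) (by
      rw [← cancel_mono (Abelian.image.ι S.g)]; simp)).ShortExact :=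
    { exact := by
        let φ : ShortComplex.mk S.f (Abelian.factorThruImage S.g) (by
            rw [← cancel_mono (Abelian.image.ι S.g)]; simp) ⟶ S :=
          { τ₁ := 𝟙 _, τ₂ := 𝟙 _, τ₃ := Abelian.image.ι S.g }
        have : Epi φ.τ₁ := inferInstanceAs (Epi (𝟙 _))
        have : IsIso φ.τ₂ := inferInstanceAs (IsIso (𝟙 _))
        have : Mono φ.τ₃ := inferInstanceAs (Mono (Abelian.image.ι S.g))
        exact (ShortComplex.exact_iff_of_epi_of_isIso_of_mono φ).2 hS }
  exact ((shortExact_kernel (cokernel.π S.g)).hasProjectiveDimensionLT_X₃_iff (n + 1) h₃).trans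
    (h.hasProjectiveDimensionLT_X₃_iff n h₂)

variable {C : Type w} [Category.{v} C] [Abelian C] [HasCoproducts.{v} C]
  {D : Type w'} [Category.{v} D] [Abelian D]
  {F : C ⥤ D} [F.Additive] [PreservesFiniteLimits F] {N : C}

omit [Abelian D] [F.Additive] [PreservesFiniteLimits F] in
lemma HomLike.projective_obj (hF : HomLike F N) (X : C) [Projective X] :
    Projective (F.obj X) :=
  (hF.projective_iff X).2 ⟨PEmpty, StableRetract.of_projective _ _⟩

omit [HasCoproducts.{v} C] in
/-- Every object is the kernel of a morphism between injective objects. -/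
lemma exists_injective_copresentation [EnoughInjectives C] (X : C) :
    ∃ S : ShortComplex C, S.X₁ = X ∧ S.Exact ∧ Mono S.f ∧ Injective S.X₂ ∧ Injective S.X₃ := by
  let g := cokernel.π (Injective.ι X) ≫ Injective.ι (cokernel (Injective.ι X))
  refine ⟨ShortComplex.mk (Injective.ι X) g (by simp [g]), rfl, ?_, inferInstance,
    inferInstance, inferInstance⟩
  let φ : ShortComplex.mk (Injective.ι X) (cokernel.π (Injective.ι X)) (by simp) ⟶
      ShortComplex.mk (Injective.ι X) g (by simp [g]) :=
    { τ₁ := 𝟙 _, τ₂ := 𝟙 _, τ₃ := Injective.ι _ }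
  have : Epi φ.τ₁ := inferInstanceAs (Epi (𝟙 _))
  have : IsIso φ.τ₂ := inferInstanceAs (IsIso (𝟙 _))
  have : Mono φ.τ₃ := inferInstanceAs (Mono (Injective.ι _))
  exact (ShortComplex.exact_iff_of_epi_of_isIso_of_mono φ).1
    (ShortComplex.exact_of_g_is_cokernel _ (cokernelIsCokernel _))

omit [F.Additive] [PreservesFiniteLimits F] in
/-- Every object of the target is the cokernel of the image of a morphism. -/
lemma HomLike.exists_cokernel_iso [F.Full] [EnoughProjectives D] (hF : HomLike F N) (Y : D) :
    ∃ (X₁ X₀ : C) (f : X₁ ⟶ X₀), Projective (F.obj X₁) ∧ Projective (F.obj X₀) ∧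
      Nonempty (cokernel (F.map f) ≅ Y) := by
  obtain ⟨X₀, ⟨e₀⟩⟩ := hF.exists_iso (Projective.over Y) inferInstance
  obtain ⟨X₁, ⟨e₁⟩⟩ := hF.exists_iso (Projective.over (kernel (Projective.π Y))) inferInstance
  obtain ⟨f, hf⟩ := F.map_surjective
    (e₁.hom ≫ Projective.π _ ≫ kernel.ι (Projective.π Y) ≫ e₀.inv)
  refine ⟨X₁, X₀, f, Projective.of_iso e₁.symm inferInstance,
    Projective.of_iso e₀.symm inferInstance, ⟨?_⟩⟩
  let g := Projective.π _ ≫ kernel.ι (Projective.π Y)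
  have hg : g ≫ Projective.π Y = 0 := by simp [g]
  have hex : (ShortComplex.mk g (Projective.π Y) hg).Exact := by
    let φ : ShortComplex.mk g (Projective.π Y) hg ⟶
        ShortComplex.mk (kernel.ι (Projective.π Y)) (Projective.π Y) (by simp) :=
      { τ₁ := Projective.π _, τ₂ := 𝟙 _, τ₃ := 𝟙 _ }
    have : Epi φ.τ₁ := inferInstanceAs (Epi (Projective.π _))
    have : IsIso φ.τ₂ := inferInstanceAs (IsIso (𝟙 _))
    have : Mono φ.τ₃ := inferInstanceAs (Mono (𝟙 _))
    exact (ShortComplex.exact_iff_of_epi_of_isIso_of_mono φ).2 (shortExact_kernel _).exact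
  exact cokernel.mapIso (F.map f) g e₁ e₀ (by rw [hf]; simp [g]) ≪≫
    (cokernelIsCokernel g).coconePointUniqueUpToIso hex.gIsCokernel

lemma HomLike.forall_hasProjectiveDimensionLT_iff [F.Full] [EnoughProjectives D]
    [EnoughInjectives C] (hPI : ∀ X : C, Projective X ↔ Injective X) (hF : HomLike F N) (r : ℕ) :
    (∀ Y : D, HasProjectiveDimensionLT Y (r + 3)) ↔
      ∀ X : C, HasProjectiveDimensionLT (F.obj X) (r + 1) := by
  constructor
  · intro h X
    obtain ⟨S, rfl, hS, hm, h₂, h₃⟩ := exists_injective_copresentation X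
    have := (hPI _).2 h₂
    have := (hPI _).2 h₃
    obtain ⟨hS', hm'⟩ := map_exact_mono F hS
    exact (hasProjectiveDimensionLT_cokernel_iff hS' (hF.projective_obj S.X₂)
      (hF.projective_obj S.X₃) r).1 (h _)
  · intro h Y
    obtain ⟨X₁, X₀, f, h₁, h₀, ⟨e⟩⟩ := hF.exists_cokernel_iso Y
    have hS : (ShortComplex.mk (kernel.ι f) f (kernel.condition f)).Exact :=
      ShortComplex.exact_of_f_is_kernel _ (kernelIsKernel f)
    obtain ⟨hS', hm'⟩ := map_exact_mono F hS
    have : HasProjectiveDimensionLT (cokernel (F.map f)) (r + 3) :=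
      (hasProjectiveDimensionLT_cokernel_iff hS' h₁ h₀ r).2 (h _)
    exact hasProjectiveDimensionLT_of_iso e _

lemma HomLike.projective_of_forall_hasProjectiveDimensionLT_two [F.Full] [F.Faithful]
    [EnoughInjectives C] (hPI : ∀ X : C, Projective X ↔ Injective X) (hF : HomLike F N)
    (h : ∀ Y : D, HasProjectiveDimensionLT Y 2) (X : C) : Projective X := by
  obtain ⟨S, rfl, hS, hm, h₂, h₃⟩ := exists_injective_copresentation X
  have := (hPI _).2 h₂
  have := (hPI _).2 h₃
  obtain ⟨hS', hm'⟩ := map_exact_mono F hS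
  have hI := ((shortExact_kernel (cokernel.π (F.map S.g))).hasProjectiveDimensionLT_X₃_iff 0
    (hF.projective_obj S.X₃)).1 (h _)
  rw [zero_add, ← projective_iff_hasProjectiveDimensionLT_one] at hI
  have hI' : Projective (Abelian.image (F.map S.g)) := hI
  let q := Projective.factorThru (𝟙 _) (Abelian.factorThruImage (F.map S.g))
  have hq : q ≫ Abelian.factorThruImage (F.map S.g) = 𝟙 _ := Projective.factorThru_comp _ _
  have hz : (𝟙 _ - Abelian.factorThruImage (F.map S.g) ≫ q) ≫ F.map S.g = 0 := by
    have := q ≫= Abelian.image.fac (F.map S.g)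
    rw [reassoc_of% hq] at this
    simp [Preadditive.sub_comp, ← this]
  let t : F.obj S.X₂ ⟶ F.obj S.X₁ := hS'.lift (𝟙 _ - Abelian.factorThruImage (F.map S.g) ≫ q) hz
  have ht : t ≫ F.map S.f = 𝟙 _ - Abelian.factorThruImage (F.map S.g) ≫ q := hS'.lift_f _ _
  have hft : F.map S.f ≫ t = 𝟙 _ := by
    have : Mono (F.map S.f) := hm'
    have hz : F.map S.f ≫ Abelian.factorThruImage (F.map S.g) = 0 := by
      rw [← cancel_mono (Abelian.image.ι _)]
      simp [← F.map_comp]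
    rw [← cancel_mono (F.map S.f), Category.assoc, ht]
    simp [reassoc_of% hz]
  obtain ⟨t', ht'⟩ := F.map_surjective t
  have : S.f ≫ t' = 𝟙 _ := F.map_injective (by rw [F.map_comp, ht', hft, F.map_id])
  exact Retract.projective { i := S.f, r := t', retract := this }

omit [F.Additive] [PreservesFiniteLimits F] in
lemma HomLike.projective_of_forall_projective [F.Full] [EnoughProjectives D]
    (hPI : ∀ X : C, Projective X ↔ Injective X) (hF : HomLike F N)
    (h : ∀ X : C, Projective X) (Y : D) : Projective Y := by
  obtain ⟨X₁, X₀, f, h₁, h₀, ⟨e⟩⟩ := hF.exists_cokernel_iso Y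
  have := h (Abelian.image f)
  have := (hPI (Abelian.image f)).1 this
  let s := Projective.factorThru (𝟙 _) (Abelian.factorThruImage f)
  have hs : s ≫ Abelian.factorThruImage f = 𝟙 _ := Projective.factorThru_comp _ _
  let t := Injective.factorThru (𝟙 _) (Abelian.image.ι f)
  have ht : Abelian.image.ι f ≫ t = 𝟙 _ := Injective.comp_factorThru _ _
  have hf : f ≫ (t ≫ s) ≫ f = f := by
    have := Abelian.image.fac f
    have h₁ : f ≫ t = Abelian.factorThruImage f := by
      have := this =≫ t
      rw [Category.assoc, ht, Category.comp_id] at this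
      exact this.symm
    have h₂ : s ≫ f = Abelian.image.ι f := by
      have := s ≫= this
      rw [reassoc_of% hs] at this
      exact this.symm
    rw [Category.assoc, h₂, reassoc_of% h₁, this]
  let u := cokernel.desc (F.map f) (𝟙 _ - F.map (t ≫ s) ≫ F.map f) (by
    rw [Preadditive.comp_sub, ← F.map_comp, ← F.map_comp, hf]; simp)
  have hu : u ≫ cokernel.π (F.map f) = 𝟙 _ := by
    rw [← cancel_epi (cokernel.π (F.map f))]
    simp [u]
  exact Projective.of_iso e (Retract.projective { i := u, r := _, retract := hu })

theorem HomLike.forall_hasProjectiveDimensionLT_iff_of_syzygy [AB4 C] [EnoughProjectives C]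
    [EnoughInjectives C] [F.Full] [F.Faithful] [EnoughProjectives D]
    (hPI : ∀ X : C, Projective X ↔ Injective X)
    {D' : Type w'} [Category.{v} D'] [Abelian D'] [EnoughProjectives D'] {F' : C ⥤ D'}
    [F'.Additive] [PreservesFiniteLimits F'] [F'.Full] [F'.Faithful]
    {T : ShortComplex C} (hT : T.ShortExact) [Projective T.X₂]
    (hF : HomLike F T.X₃) (hF' : HomLike F' T.X₁) (r : ℕ) :
    (∀ Y : D, HasProjectiveDimensionLT Y (r + 1)) ↔
      ∀ Y : D', HasProjectiveDimensionLT Y (r + 1) := by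
  match r with
  | 0 =>
    simp only [zero_add, ← projective_iff_hasProjectiveDimensionLT_one]
    refine ⟨fun h => hF'.projective_of_forall_projective hPI
      (hF.projective_of_forall_hasProjectiveDimensionLT_two hPI fun Y => ?_),
      fun h => hF.projective_of_forall_projective hPI
      (hF'.projective_of_forall_hasProjectiveDimensionLT_two hPI fun Y => ?_)⟩
    · have := projective_iff_hasProjectiveDimensionLT_one.1 (h Y)
      exact hasProjectiveDimensionLT_of_ge Y 1 2 (by omega)
    · have := projective_iff_hasProjectiveDimensionLT_one.1 (h Y)
      exact hasProjectiveDimensionLT_of_ge Y 1 2 (by omega)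
  | 1 =>
    refine ⟨fun h Y => ?_, fun h Y => ?_⟩
    · have := projective_iff_hasProjectiveDimensionLT_one.1
        (hF'.projective_of_forall_projective hPI
          (hF.projective_of_forall_hasProjectiveDimensionLT_two hPI h) Y)
      exact hasProjectiveDimensionLT_of_ge Y 1 2 (by omega)
    · have := projective_iff_hasProjectiveDimensionLT_one.1
        (hF.projective_of_forall_projective hPI
          (hF'.projective_of_forall_hasProjectiveDimensionLT_two hPI h) Y)
      exact hasProjectiveDimensionLT_of_ge Y 1 2 (by omega)
  | r + 2 =>
    rw [hF.forall_hasProjectiveDimensionLT_iff hPI, hF'.forall_hasProjectiveDimensionLT_iff hPI]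
    refine ⟨fun h X => ?_, fun h X => ?_⟩
    · let S := ShortComplex.mk (Injective.ι X) (cokernel.π (Injective.ι X)) (by simp)
      have hS : S.ShortExact :=
        { exact := ShortComplex.exact_of_g_is_cokernel _ (cokernelIsCokernel _) }
      have : Projective S.X₂ := (hPI _).2 (inferInstanceAs (Injective (Injective.under X)))
      exact (hF.hasProjectiveDimensionLT_iff_syzygy hPI hT hF' r hS).1 (h _)
    · have : Projective (ShortComplex.mk _ _ (kernel.condition (Projective.π X))).X₂ :=
        inferInstanceAs (Projective (Projective.over X))
      exact (hF.hasProjectiveDimensionLT_iff_syzygy hPI hT hF' r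
        (shortExact_kernel (Projective.π X))).2 (h _)

end GlobalDimension

section ProjectiveDimension

lemma hasProjectiveDimensionLT_of_projDimLE {A : Type u} [Ring A] {r : ℕ} :
    ∀ {Y : ModuleCat.{u} A}, ProjDimLE A Y r → HasProjectiveDimensionLT Y (r + 1) := by
  induction r with
  | zero =>
    rintro Y ⟨P, d, f, hP, hz, hf, ⟨w, h₀⟩, -⟩
    have : Mono f := h₀.mono_g ((hz 1 (by omega)).eq_of_src _ _)
    have : IsIso f := isIso_of_mono_of_epi f
    rw [zero_add, ← projective_iff_hasProjectiveDimensionLT_one]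
    exact Projective.of_iso (asIso f) (hP 0)
  | succ r ih =>
    rintro Y ⟨P, d, f, hP, hz, hf, ⟨w, h₀⟩, h⟩
    refine ((shortExact_kernel f).hasProjectiveDimensionLT_X₃_iff r (hP 0)).2 (ih
      ⟨fun i => P (i + 1), fun i => d (i + 1), kernel.lift f (d 0) w, fun i => hP _,
        fun i hi => hz _ (by omega), (ShortComplex.exact_iff_epi_kernel_lift _).1 h₀, ?_,
        fun i => h (i + 1)⟩)
    obtain ⟨w', h'⟩ := h 0
    refine ⟨by rw [← cancel_mono (kernel.ι f)]; simpa using w', ?_⟩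
    let φ : ShortComplex.mk (d 1) (kernel.lift f (d 0) w)
        (by rw [← cancel_mono (kernel.ι f)]; simpa using w') ⟶ ShortComplex.mk _ _ w' :=
      { τ₁ := 𝟙 _, τ₂ := 𝟙 _, τ₃ := kernel.ι f }
    have : Epi φ.τ₁ := inferInstanceAs (Epi (𝟙 _))
    have : IsIso φ.τ₂ := inferInstanceAs (IsIso (𝟙 _))
    have : Mono φ.τ₃ := inferInstanceAs (Mono (kernel.ι f))
    exact (ShortComplex.exact_iff_of_epi_of_isIso_of_mono φ).2 h'

lemma projDimLE_of_hasProjectiveDimensionLT {A : Type u} [Ring A] {r : ℕ} :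
    ∀ {Y : ModuleCat.{u} A}, HasProjectiveDimensionLT Y (r + 1) → ProjDimLE A Y r := by
  induction r with
  | zero =>
    intro Y hY
    rw [zero_add, ← projective_iff_hasProjectiveDimensionLT_one] at hY
    have hz : IsZero (ModuleCat.of A PUnit.{u + 1}) := ModuleCat.isZero_of_subsingleton _
    refine ⟨fun | 0 => Y | _ + 1 => ModuleCat.of A PUnit, fun | 0 => 0 | _ + 1 => 0, 𝟙 Y,
      fun | 0 => hY | _ + 1 => Projective.of_iso (hz.iso (isZero_zero _)).symm inferInstance,
      fun | 0 => fun h => absurd h (by omega) | _ + 1 => fun _ => hz, inferInstance,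
      ⟨by simp, ?_⟩, fun i => ⟨by cases i <;> simp, ?_⟩⟩
    · rw [ShortComplex.exact_iff_mono _ rfl]
      exact inferInstanceAs (Mono (𝟙 _))
    · exact ShortComplex.exact_of_isZero_X₂ _ hz
  | succ r ih =>
    intro Y hY
    have hK := ((shortExact_kernel (Projective.π Y)).hasProjectiveDimensionLT_X₃_iff r
      (inferInstanceAs (Projective (Projective.over Y)))).1 hY
    obtain ⟨P, d, f, hP, hz, hf, ⟨w, h₀⟩, h⟩ := ih hK
    refine ⟨fun | 0 => Projective.over Y | i + 1 => P i,
      fun | 0 => f ≫ kernel.ι _ | i + 1 => d i, Projective.π Y,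
      fun | 0 => inferInstanceAs (Projective (Projective.over Y)) | i + 1 => hP i,
      fun | 0 => fun h => absurd h (by omega) | i + 1 => fun h => hz _ (by omega),
      inferInstance, ⟨by simp, ?_⟩, ?_⟩
    · let φ : ShortComplex.mk (f ≫ kernel.ι (Projective.π Y)) (Projective.π Y) (by simp) ⟶
          ShortComplex.mk (kernel.ι (Projective.π Y)) (Projective.π Y) (by simp) :=
        { τ₁ := f, τ₂ := 𝟙 _, τ₃ := 𝟙 _ }
      have : Epi φ.τ₁ := hf
      have : IsIso φ.τ₂ := inferInstanceAs (IsIso (𝟙 _))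
      have : Mono φ.τ₃ := inferInstanceAs (Mono (𝟙 _))
      exact (ShortComplex.exact_iff_of_epi_of_isIso_of_mono φ).2 (shortExact_kernel _).exact
    · rintro (_ | i)
      · have hw : d 0 ≫ f ≫ kernel.ι (Projective.π Y) = 0 := by
          rw [← Category.assoc, w, zero_comp]
        refine ⟨hw, ?_⟩
        let φ : ShortComplex.mk (d 0) f w ⟶
            ShortComplex.mk (d 0) (f ≫ kernel.ι (Projective.π Y)) hw :=
          { τ₁ := 𝟙 _, τ₂ := 𝟙 _, τ₃ := kernel.ι _ }
        have : Epi φ.τ₁ := inferInstanceAs (Epi (𝟙 _))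
        have : IsIso φ.τ₂ := inferInstanceAs (IsIso (𝟙 _))
        have : Mono φ.τ₃ := inferInstanceAs (Mono (kernel.ι _))
        exact (ShortComplex.exact_iff_of_epi_of_isIso_of_mono φ).1 h₀
      · exact h i

lemma gldimLE_iff (A : Type u) [Ring A] (r : ℕ) :
    GldimLE A r ↔ ∀ Y : ModuleCat.{u} A, HasProjectiveDimensionLT Y (r + 1) :=
  forall_congr' fun _ => ⟨hasProjectiveDimensionLT_of_projDimLE,
    projDimLE_of_hasProjectiveDimensionLT⟩

end ProjectiveDimension

section ExtVanishing

universe v w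

open Abelian

variable {C : Type w} [Category.{v} C] [Abelian C] [HasExt.{v} C]

lemma subsingleton_ext_succ_iff {S : ShortComplex C} (hS : S.ShortExact) [Injective S.X₂]
    (N : C) (n : ℕ) :
    Subsingleton (Ext N S.X₁ (n + 2)) ↔ Subsingleton (Ext N S.X₃ (n + 1)) := by
  constructor
  · refine fun h => subsingleton_of_forall_eq 0 fun x => ?_
    obtain ⟨y, rfl⟩ := Ext.covariant_sequence_exact₃ N hS x (n₁ := n + 2) rfl
      (Subsingleton.elim _ _)
    rw [Ext.eq_zero_of_injective y, Ext.zero_comp]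
  · refine fun h => subsingleton_of_forall_eq 0 fun x => ?_
    obtain ⟨y, rfl⟩ := Ext.covariant_sequence_exact₁ N hS x (Ext.eq_zero_of_injective _)
      (n₀ := n + 1) rfl
    rw [Subsingleton.elim y 0, Ext.zero_comp]

lemma subsingleton_ext_one_iff {S : ShortComplex C} (hS : S.ShortExact) [Injective S.X₂] (N : C) :
    Subsingleton (Ext N S.X₁ 1) ↔ ∀ n : N ⟶ S.X₃, ∃ m : N ⟶ S.X₂, m ≫ S.g = n := by
  constructor
  · intro h n
    obtain ⟨y, hy⟩ := Ext.covariant_sequence_exact₃ N hS (Ext.mk₀ n) (n₁ := 1) rfl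
      (Subsingleton.elim _ _)
    obtain ⟨m, rfl⟩ := (Ext.mk₀_bijective _ _).2 y
    rw [Ext.mk₀_comp_mk₀] at hy
    exact ⟨m, (Ext.mk₀_bijective _ _).1 hy⟩
  · refine fun h => subsingleton_of_forall_eq 0 fun x => ?_
    obtain ⟨y, rfl⟩ := Ext.covariant_sequence_exact₁ N hS x (Ext.eq_zero_of_injective _)
      (n₀ := 0) rfl
    obtain ⟨n, rfl⟩ := (Ext.mk₀_bijective _ _).2 y
    obtain ⟨m, rfl⟩ := h n
    rw [← Ext.mk₀_comp_mk₀, Ext.comp_assoc_of_second_deg_zero, hS.comp_extClass, Ext.comp_zero]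

lemma subsingleton_ext_succ_iff' {S : ShortComplex C} (hS : S.ShortExact) [Projective S.X₂]
    (Y : C) (n : ℕ) :
    Subsingleton (Ext S.X₃ Y (n + 2)) ↔ Subsingleton (Ext S.X₁ Y (n + 1)) := by
  constructor
  · refine fun h => subsingleton_of_forall_eq 0 fun x => ?_
    obtain ⟨y, rfl⟩ := Ext.contravariant_sequence_exact₁ hS Y x (n₁ := n + 2) (by omega)
      (Subsingleton.elim _ _)
    rw [Ext.eq_zero_of_projective y, Ext.comp_zero]
  · refine fun h => subsingleton_of_forall_eq 0 fun x => ?_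
    obtain ⟨y, rfl⟩ := Ext.contravariant_sequence_exact₃ hS Y x (Ext.eq_zero_of_projective _)
      (n₀ := n + 1) (by omega)
    rw [Subsingleton.elim y 0, Ext.comp_zero]

lemma StableRetract.subsingleton_ext (hPI : ∀ X : C, Projective X ↔ Injective X) {X X' : C}
    (h : StableRetract X X') (N : C) (n : ℕ) (h' : Subsingleton (Ext N X' (n + 1))) :
    Subsingleton (Ext N X (n + 1)) := by
  obtain ⟨Q, i, r, a, b, hQ, e⟩ := h
  have := (hPI Q).1 hQ
  refine subsingleton_of_forall_eq 0 fun x => ?_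
  rw [← Ext.comp_mk₀_id x, ← e, Ext.mk₀_add, Ext.comp_add, ← Ext.mk₀_comp_mk₀, ← Ext.mk₀_comp_mk₀,
    ← Ext.comp_assoc_of_third_deg_zero, ← Ext.comp_assoc_of_third_deg_zero,
    Subsingleton.elim (x.comp (Ext.mk₀ i) _) 0, Ext.eq_zero_of_injective (x.comp (Ext.mk₀ a) _)]
  simp

end ExtVanishing

section DominantDimension

universe v w w'

/-- `Y` has a coresolution whose first `r` terms are projective and injective. -/
def DomdimObjGE {D : Type w'} [Category.{v} D] [Abelian D] : ℕ → D → Prop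
  | 0, _ => True
  | r + 1, Y => ∃ (I : D) (f : Y ⟶ I), Mono f ∧ Injective I ∧ Projective I ∧
      DomdimObjGE r (cokernel f)

lemma DomdimObjGE.of_iso {D : Type w'} [Category.{v} D] [Abelian D] {r : ℕ} {Y Y' : D}
    (e : Y ≅ Y') (h : DomdimObjGE r Y) : DomdimObjGE r Y' := by
  induction r generalizing Y Y' with
  | zero => trivial
  | succ r ih =>
    obtain ⟨I, f, hf, hi, hp, h⟩ := h
    exact ⟨I, e.inv ≫ f, inferInstance, hi, hp, ih (cokernelEpiComp e.inv f).symm h⟩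

lemma DomdimObjGE.of_succ {D : Type w'} [Category.{v} D] [Abelian D] {r : ℕ} {Y : D}
    (h : DomdimObjGE (r + 1) Y) : DomdimObjGE r Y := by
  induction r generalizing Y with
  | zero => trivial
  | succ r ih =>
    obtain ⟨I, f, hf, hi, hp, h⟩ := h
    exact ⟨I, f, hf, hi, hp, ih h⟩

lemma injective_of_injective_obj {C : Type w} [Category.{v} C] {D : Type w'} [Category.{v} D]
    (F : C ⥤ D) [HasPullbacks C] [PreservesFiniteLimits F] [EnoughInjectives C] [F.Full]
    [F.Faithful] {X : C}
    (h : Injective (F.obj X)) : Injective X := by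
  have : Mono (F.map (Injective.ι X)) := inferInstance
  obtain ⟨t, ht⟩ := F.map_surjective (Injective.factorThru (𝟙 (F.obj X)) (F.map (Injective.ι X)))
  have hr : Injective.ι X ≫ t = 𝟙 X := F.map_injective (by
    rw [F.map_comp, ht, Injective.comp_factorThru, F.map_id])
  exact Retract.injective { i := Injective.ι X, r := t, retract := hr }

variable {C : Type w} [Category.{v} C] [Abelian C] [HasCoproducts.{v} C]
  {D : Type w'} [Category.{v} D] [Abelian D]
  {F : C ⥤ D} [F.Additive] [PreservesFiniteLimits F] [F.PreservesInjectiveObjects] {N : C}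

/-- The cokernel of the first map of a short exact sequence with second term `Y`. -/
lemma DomdimObjGE.succ_of_shortExact {S : ShortComplex D} (hS : S.ShortExact) {r : ℕ}
    (hi : Injective S.X₂) (hp : Projective S.X₂) (h : DomdimObjGE r S.X₃) :
    DomdimObjGE (r + 1) S.X₁ :=
  have := hS.epi_g
  ⟨S.X₂, S.f, hS.mono_f, hi, hp,
    h.of_iso (hS.exact.gIsCokernel.coconePointUniqueUpToIso (colimit.isColimit _))⟩

lemma HomLike.domdimObjGE_two [EnoughInjectives C] (hPI : ∀ X : C, Projective X ↔ Injective X)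
    (hF : HomLike F N) (X : C) : DomdimObjGE 2 (F.obj X) := by
  obtain ⟨S, rfl, hS, hm, h₂, h₃⟩ := exists_injective_copresentation X
  have := (hPI _).2 h₂
  have := (hPI _).2 h₃
  obtain ⟨hS', hm'⟩ := map_exact_mono F hS
  have hF₂ : Injective (F.obj S.X₂) := inferInstance
  have hF₃ : Injective (F.obj S.X₃) := inferInstance
  exact ⟨F.obj S.X₂, F.map S.f, hm', hF₂, hF.projective_obj _, F.obj S.X₃,
    cokernel.desc _ _ (S.map F).zero, (ShortComplex.exact_iff_mono_cokernel_desc _).1 hS', hF₃,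
    hF.projective_obj _, trivial⟩

omit [Abelian D] [F.Additive] [F.PreservesInjectiveObjects] in
lemma HomLike.exists_iso_of_injective_projective [EnoughInjectives C] [F.Full] [F.Faithful]
    (hF : HomLike F N) (I : D) (hi : Injective I) (hp : Projective I) :
    ∃ E : C, Injective E ∧ Nonempty (F.obj E ≅ I) := by
  obtain ⟨E, ⟨e⟩⟩ := hF.exists_iso I hp
  exact ⟨E, injective_of_injective_obj F (Injective.of_iso e.symm hi), ⟨e⟩⟩

omit [F.PreservesInjectiveObjects] in
lemma HomLike.exists_iso_of_domdimObjGE_two [EnoughInjectives C] [F.Full] [F.Faithful]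
    (hF : HomLike F N) (Y : D) (h : DomdimObjGE 2 Y) : ∃ X : C, Nonempty (F.obj X ≅ Y) := by
  obtain ⟨I, f, hf, hi, hp, J, g, hg, hi', hp', -⟩ := h
  obtain ⟨E, -, ⟨e⟩⟩ := hF.exists_iso_of_injective_projective I hi hp
  obtain ⟨E', -, ⟨e'⟩⟩ := hF.exists_iso_of_injective_projective J hi' hp'
  obtain ⟨z, hz⟩ := F.map_surjective (e.hom ≫ (cokernel.π f ≫ g) ≫ e'.inv)
  have hS : (ShortComplex.mk f (cokernel.π f ≫ g) (by simp)).Exact := by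
    let φ : ShortComplex.mk f (cokernel.π f) (by simp) ⟶
        ShortComplex.mk f (cokernel.π f ≫ g) (by simp) :=
      { τ₁ := 𝟙 _, τ₂ := 𝟙 _, τ₃ := g }
    have : Epi φ.τ₁ := inferInstanceAs (Epi (𝟙 _))
    have : IsIso φ.τ₂ := inferInstanceAs (IsIso (𝟙 _))
    have : Mono φ.τ₃ := hg
    exact (ShortComplex.exact_iff_of_epi_of_isIso_of_mono φ).1
      (ShortComplex.exact_of_g_is_cokernel _ (cokernelIsCokernel _))
  have hf' : Mono (ShortComplex.mk f (cokernel.π f ≫ g) (by simp)).f := hf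
  exact ⟨kernel z, ⟨PreservesKernel.iso F z ≪≫ kernel.mapIso _ _ e e' (by rw [hz]; simp) ≪≫
    (kernelIsKernel _).conePointUniqueUpToIso hS.fIsKernel⟩⟩

omit [F.PreservesInjectiveObjects] in
lemma HomLike.shortExact_of_map [F.Full] [F.Faithful] (hF : HomLike F N) {S : ShortComplex C}
    (hS : (S.map F).ShortExact) : S.ShortExact := by
  have : Mono (F.map S.f) := hS.mono_f
  exact
  { exact := by
      rw [ShortComplex.exact_iff_exact_up_to_refinements]
      intro U x hx
      have : Mono (S.map F).f := hS.mono_f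
      have hx' : F.map x ≫ (S.map F).g = 0 := by
        change F.map x ≫ F.map S.g = 0
        rw [← F.map_comp, hx, F.map_zero]
      obtain ⟨l, hl⟩ := F.map_surjective (hS.exact.lift (F.map x) hx')
      refine ⟨U, 𝟙 U, inferInstance, l, F.map_injective ?_⟩
      have := hS.exact.lift_f (F.map x) hx'
      rw [← hl] at this
      rw [Category.id_comp, F.map_comp]
      exact this.symm
    mono_f := F.mono_of_mono_map this
    epi_g := ((hF.epi_map_iff S.g).1 hS.epi_g).1 }

/-- The dominant dimension of `Hom(G, X)` is governed by the vanishing of `Ext(N, X)`. -/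
theorem HomLike.domdimObjGE_iff [HasExt.{v} C] [EnoughInjectives C] [F.Full] [F.Faithful]
    (hPI : ∀ X : C, Projective X ↔ Injective X) (hF : HomLike F N) (r : ℕ) (X : C) :
    DomdimObjGE (r + 2) (F.obj X) ↔ ∀ i < r, Subsingleton (Abelian.Ext N X (i + 1)) := by
  induction r generalizing X with
  | zero => simpa using hF.domdimObjGE_two hPI X
  | succ r ih =>
    have key {S : ShortComplex C} (hS : S.ShortExact) (hI : Injective S.X₂) :
        (∀ i < r + 1, Subsingleton (Abelian.Ext N S.X₁ (i + 1))) ↔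
          (∀ n : N ⟶ S.X₃, ∃ m : N ⟶ S.X₂, m ≫ S.g = n) ∧
            DomdimObjGE (r + 2) (F.obj S.X₃) := by
      rw [ih, ← subsingleton_ext_one_iff hS]
      constructor
      · exact fun h => ⟨h 0 (by omega), fun i hi =>
          (subsingleton_ext_succ_iff hS N i).1 (h (i + 1) (by omega))⟩
      · rintro ⟨h₁, h₂⟩ (_ | i) hi
        · exact h₁
        · exact (subsingleton_ext_succ_iff hS N i).2 (h₂ i (by omega))
    constructor
    · rintro ⟨I, f, hf, hi, hp, h⟩
      have h₂ : DomdimObjGE 2 (cokernel f) := by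
        clear * - h
        induction r with
        | zero => exact h
        | succ r ih => exact ih h.of_succ
      obtain ⟨Z, ⟨c⟩⟩ := hF.exists_iso_of_domdimObjGE_two _ h₂
      obtain ⟨E, hE, ⟨e⟩⟩ := hF.exists_iso_of_injective_projective I hi hp
      obtain ⟨a, ha⟩ := F.map_surjective (f ≫ e.inv)
      obtain ⟨b, hb⟩ := F.map_surjective (e.hom ≫ cokernel.π f ≫ c.inv)
      let S := ShortComplex.mk a b (F.map_injective (by simp [ha, hb]))
      have hS : (S.map F).ShortExact := by
        have h₀ : (ShortComplex.mk f (cokernel.π f) (cokernel.condition f)).ShortExact :=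
          { exact := ShortComplex.exact_of_g_is_cokernel _ (cokernelIsCokernel _) }
        let φ : ShortComplex.mk f (cokernel.π f) (cokernel.condition f) ≅ S.map F :=
          ShortComplex.isoMk (Iso.refl (F.obj X)) e.symm c.symm
            ((Category.id_comp (F.map a)).trans ha)
            ((congrArg (e.inv ≫ ·) hb).trans (e.inv_hom_id_assoc _))
        exact ShortComplex.shortExact_of_iso φ h₀
      exact (key (hF.shortExact_of_map hS) hE).2
        ⟨((hF.epi_map_iff b).1 hS.epi_g).2, h.of_iso c.symm⟩
    · intro h
      let S := ShortComplex.mk (Injective.ι X) (cokernel.π (Injective.ι X)) (by simp)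
      have hS : S.ShortExact :=
        { exact := ShortComplex.exact_of_g_is_cokernel _ (cokernelIsCokernel _) }
      have hI : Injective S.X₂ := inferInstanceAs (Injective (Injective.under X))
      have hP := (hPI _).2 hI
      obtain ⟨h₁, h₂⟩ := (key hS hI).1 h
      exact DomdimObjGE.succ_of_shortExact (hF.map_shortExact hS h₁)
        (inferInstanceAs (Injective (F.obj S.X₂))) (hF.projective_obj S.X₂) h₂

theorem HomLike.domdimObjGE_iff_of_syzygy [HasExt.{v} C] [EnoughInjectives C]
    [F.Full] [F.Faithful] (hPI : ∀ X : C, Projective X ↔ Injective X)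
    {D' : Type w'} [Category.{v} D'] [Abelian D'] {F' : C ⥤ D'} [F'.Additive]
    [PreservesFiniteLimits F'] [F'.Full] [F'.Faithful] [F'.PreservesInjectiveObjects]
    {T : ShortComplex C} (hT : T.ShortExact) [Projective T.X₂]
    (hF : HomLike F T.X₃) (hF' : HomLike F' T.X₁) {G G' : C}
    (h₁ : StableRetract G T.X₃) (h₂ : StableRetract T.X₃ G)
    (h₁' : StableRetract G' T.X₁) (h₂' : StableRetract T.X₁ G') (r : ℕ) :
    DomdimObjGE r (F.obj G) ↔ DomdimObjGE r (F'.obj G') := by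
  have := (hPI T.X₂).1 inferInstance
  match r with
  | 0 => rfl
  | 1 => exact iff_of_true (hF.domdimObjGE_two hPI G).of_succ (hF'.domdimObjGE_two hPI G').of_succ
  | r + 2 =>
    rw [hF.domdimObjGE_iff hPI, hF'.domdimObjGE_iff hPI]
    refine forall₂_congr fun i _ => ?_
    calc Subsingleton (Abelian.Ext T.X₃ G (i + 1))
      _ ↔ Subsingleton (Abelian.Ext T.X₃ T.X₃ (i + 1)) :=
        ⟨h₂.subsingleton_ext hPI _ i, h₁.subsingleton_ext hPI _ i⟩
      _ ↔ Subsingleton (Abelian.Ext T.X₃ T.X₁ (i + 2)) := (subsingleton_ext_succ_iff hT _ i).symm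
      _ ↔ Subsingleton (Abelian.Ext T.X₁ T.X₁ (i + 1)) := subsingleton_ext_succ_iff' hT _ i
      _ ↔ Subsingleton (Abelian.Ext T.X₁ G' (i + 1)) :=
        ⟨h₁'.subsingleton_ext hPI _ i, h₂'.subsingleton_ext hPI _ i⟩

end DominantDimension

section DominantDimensionSequence

variable {A : Type u} [Ring A]

/-- The condition of `DomdimGE` for an arbitrary module in place of the regular one. -/
def HasCoresolution (Y : ModuleCat.{u} A) (r : ℕ) : Prop :=
  ∃ (I : ℕ → ModuleCat.{u} A) (f : Y ⟶ I 0) (g : ∀ i : ℕ, I i ⟶ I (i + 1)),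
    Mono f ∧ (∀ i, i < r → Injective (I i) ∧ Projective (I i)) ∧
    (2 ≤ r → ∃ w : f ≫ g 0 = 0, (ShortComplex.mk f (g 0) w).Exact) ∧
    (∀ i, i + 3 ≤ r → ∃ w : g i ≫ g (i + 1) = 0, (ShortComplex.mk (g i) (g (i + 1)) w).Exact)

lemma HasCoresolution.domdimObjGE {r : ℕ} :
    ∀ {Y : ModuleCat.{u} A}, HasCoresolution Y r → DomdimObjGE r Y := by
  induction r with
  | zero => exact fun _ => trivial
  | succ r ih =>
    rintro Y ⟨I, f, g, hf, hI, h₀, h⟩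
    refine ⟨I 0, f, hf, (hI 0 (by omega)).1, (hI 0 (by omega)).2, ?_⟩
    obtain _ | r := r
    · trivial
    obtain ⟨w, hw⟩ := h₀ (by omega)
    refine ih ⟨fun i => I (i + 1), cokernel.desc f (g 0) w, fun i => g (i + 1),
      (ShortComplex.exact_iff_mono_cokernel_desc _).1 hw, fun i hi => hI _ (by omega), ?_,
      fun i hi => h (i + 1) (by omega)⟩
    intro hr
    obtain ⟨w', hw'⟩ := h 0 (by omega)
    have hz : cokernel.desc f (g 0) w ≫ g 1 = 0 := by
      rw [← cancel_epi (cokernel.π f)]; simpa using w'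
    refine ⟨hz, ?_⟩
    let φ : ShortComplex.mk _ _ w' ⟶ ShortComplex.mk _ _ hz :=
      { τ₁ := cokernel.π f, τ₂ := 𝟙 _, τ₃ := 𝟙 _ }
    have : Epi φ.τ₁ := inferInstanceAs (Epi (cokernel.π f))
    have : IsIso φ.τ₂ := inferInstanceAs (IsIso (𝟙 _))
    have : Mono φ.τ₃ := inferInstanceAs (Mono (𝟙 _))
    exact (ShortComplex.exact_iff_of_epi_of_isIso_of_mono φ).1 hw'

lemma hasCoresolution_of_domdimObjGE {r : ℕ} :
    ∀ {Y : ModuleCat.{u} A}, DomdimObjGE r Y → HasCoresolution Y r := by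
  induction r with
  | zero =>
    exact fun {Y} _ => ⟨fun _ => Y, 𝟙 Y, fun _ => 0, inferInstance, by omega, by omega, by omega⟩
  | succ r ih =>
    rintro Y ⟨J, f, hf, hi, hp, h⟩
    obtain ⟨I, f', g, hf', hI, h₀, h⟩ := ih h
    refine ⟨fun | 0 => J | i + 1 => I i, f, fun | 0 => cokernel.π f ≫ f' | i + 1 => g i, hf,
      fun | 0 => fun _ => ⟨hi, hp⟩ | i + 1 => fun _ => hI i (by omega), fun _ => ⟨by simp, ?_⟩,
      ?_⟩
    · let φ : ShortComplex.mk f (cokernel.π f) (by simp) ⟶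
          ShortComplex.mk f (cokernel.π f ≫ f') (by simp) :=
        { τ₁ := 𝟙 _, τ₂ := 𝟙 _, τ₃ := f' }
      have : Epi φ.τ₁ := inferInstanceAs (Epi (𝟙 _))
      have : IsIso φ.τ₂ := inferInstanceAs (IsIso (𝟙 _))
      have : Mono φ.τ₃ := hf'
      exact (ShortComplex.exact_iff_of_epi_of_isIso_of_mono φ).1
        (ShortComplex.exact_of_g_is_cokernel _ (cokernelIsCokernel _))
    · rintro (_ | i) hr
      · obtain ⟨w, hw⟩ := h₀ (by omega)
        have hz : (cokernel.π f ≫ f') ≫ g 0 = 0 := by rw [Category.assoc, w, comp_zero]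
        refine ⟨hz, ?_⟩
        let φ : ShortComplex.mk _ _ hz ⟶ ShortComplex.mk _ _ w :=
          { τ₁ := cokernel.π f, τ₂ := 𝟙 _, τ₃ := 𝟙 _ }
        have : Epi φ.τ₁ := inferInstanceAs (Epi (cokernel.π f))
        have : IsIso φ.τ₂ := inferInstanceAs (IsIso (𝟙 _))
        have : Mono φ.τ₃ := inferInstanceAs (Mono (𝟙 _))
        exact (ShortComplex.exact_iff_of_epi_of_isIso_of_mono φ).2 hw
      · exact h i (by omega)

lemma domdimGE_iff (A : Type u) [Ring A] (r : ℕ) :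
    DomdimGE A r ↔ DomdimObjGE r (ModuleCat.of A A) :=
  ⟨HasCoresolution.domdimObjGE, hasCoresolution_of_domdimObjGE⟩

end DominantDimensionSequence

section EndomorphismRing

universe v w w'

/-- The projection of a copower to one of its summands. -/
noncomputable def copower.π {C : Type w} [Category.{v} C] [HasCoproducts.{v} C]
    [HasZeroMorphisms C] {I : Type v} (X : C) (i : I) : (copower C I).obj X ⟶ X :=
  open Classical in copower.desc fun j => if j = i then 𝟙 X else 0

lemma copower.ι_π_self {C : Type w} [Category.{v} C] [HasCoproducts.{v} C]
    [HasZeroMorphisms C] {I : Type v} (X : C) (i : I) : copower.ι X i ≫ copower.π X i = 𝟙 X := by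
  simp [copower.π, copower.ι_desc]

lemma copower.ι_π_of_ne {C : Type w} [Category.{v} C] [HasCoproducts.{v} C]
    [HasZeroMorphisms C] {I : Type v} (X : C) {i j : I} (h : j ≠ i) :
    copower.ι X j ≫ copower.π X i = 0 := by
  simp [copower.π, copower.ι_desc, h]

/-- Every element of a copower of modules is the sum of its finitely many nonzero components. -/
lemma copower.exists_finset {R : Type u} [Ring R] {I : Type u} (X : ModuleCat.{u} R)
    (z : (copower (ModuleCat.{u} R) I).obj X) :
    ∃ s : Finset I, ∀ t : Finset I, s ⊆ t →
      (∑ i ∈ t, copower.π X i ≫ copower.ι X i).hom z = z := by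
  classical
  let S : Submodule R ((copower (ModuleCat.{u} R) I).obj X) :=
    ⨆ i, LinearMap.range (copower.ι X i).hom
  have hS : S.mkQ = 0 := by
    have : ModuleCat.ofHom S.mkQ = 0 := copower.hom_ext fun i => by
      ext x
      simpa using le_iSup (fun i => LinearMap.range (copower.ι X i).hom) i ⟨x, rfl⟩
    simpa using congrArg ModuleCat.Hom.hom this
  have hz : z ∈ S := by rw [← Submodule.ker_mkQ S, hS]; simp
  induction hz using Submodule.iSup_induction' with
  | mem i x hx =>
    obtain ⟨x, rfl⟩ := hx
    refine ⟨{i}, fun t ht => ?_⟩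
    have : copower.ι X i ≫ (∑ i ∈ t, copower.π X i ≫ copower.ι X i) = copower.ι X i := by
      rw [Preadditive.comp_sum, Finset.sum_eq_single i]
      · rw [← Category.assoc, copower.ι_π_self, Category.id_comp]
      · intro j _ hj
        rw [← Category.assoc, copower.ι_π_of_ne _ hj.symm, zero_comp]
      · exact fun h => (h (ht (by simp))).elim
    exact congrArg (fun f => f.hom x) this
  | zero => exact ⟨∅, by simp⟩
  | add x y _ _ hx hy =>
    obtain ⟨s, hs⟩ := hx
    obtain ⟨s', hs'⟩ := hy
    refine ⟨s ∪ s', fun t ht => ?_⟩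
    rw [map_add, hs t (Finset.union_subset_left ht), hs' t (Finset.union_subset_right ht)]

/-- Morphisms from a finitely generated module to a copower factor through a finite subsum. -/
lemma copower.exists_finset_comp {R : Type u} [Ring R] {I : Type u} {G X : ModuleCat.{u} R}
    [Module.Finite R G] (f : G ⟶ (copower (ModuleCat.{u} R) I).obj X) :
    ∃ s : Finset I, f ≫ (∑ i ∈ s, copower.π X i ≫ copower.ι X i) = f := by
  classical
  obtain ⟨T, hT⟩ := Module.Finite.fg_top (R := R) (M := G)
  choose s hs using fun g : G => copower.exists_finset X (f.hom g)
  refine ⟨T.biUnion s, ?_⟩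
  ext1
  refine LinearMap.ext_on hT fun g hg => ?_
  exact hs g _ (Finset.subset_biUnion_of_mem s hg)

/-- The functor `Hom(G, -)` preserves copowers of `G` if `G` is finitely generated. -/
lemma preadditiveCoyonedaObj_isIso_desc {R : Type u} [Ring R] (I : Type u) (G : ModuleCat.{u} R)
    [Module.Finite R G] :
    IsIso (copower.desc fun i : I => (preadditiveCoyonedaObj G).map (copower.ι G i)) := by
  set F := preadditiveCoyonedaObj G
  set c := copower.desc fun i : I => F.map (copower.ι G i) with hc
  have hπ (i : I) : c ≫ F.map (copower.π G i) = copower.π (F.obj G) i :=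
    copower.hom_ext fun j => by
      rw [hc, ← Category.assoc, copower.ι_desc, ← F.map_comp]
      by_cases h : j = i
      · subst h; rw [copower.ι_π_self, copower.ι_π_self, F.map_id]
      · rw [copower.ι_π_of_ne _ h, copower.ι_π_of_ne _ h, F.map_zero]
  rw [ConcreteCategory.isIso_iff_bijective]
  refine ⟨(injective_iff_map_eq_zero c.hom).2 fun z hz => ?_, fun y => ?_⟩
  · obtain ⟨s, hs⟩ := copower.exists_finset _ z
    rw [← hs s subset_rfl]
    have h (i : I) : (copower.π (F.obj G) i).hom z = 0 := by
      rw [← hπ, ModuleCat.hom_comp, LinearMap.comp_apply, hz, map_zero]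
    simp [ModuleCat.hom_sum, h]
  · obtain ⟨s, hs⟩ := copower.exists_finset_comp (G := G) (X := G) y
    refine ⟨∑ i ∈ s, (copower.ι (F.obj G) i).hom ((F.map (copower.π G i)).hom y), ?_⟩
    have h (i : I) : copower.ι (F.obj G) i ≫ c = F.map (copower.ι G i) := copower.ι_desc _ _
    have : ∑ i ∈ s, (F.map (copower.π G i) ≫ copower.ι (F.obj G) i) ≫ c =
        F.map (∑ i ∈ s, copower.π G i ≫ copower.ι G i) := by
      simp only [F.map_sum, F.map_comp, Category.assoc, h]
    have h' := congrArg (fun f => f.hom y) this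
    simp only [ModuleCat.hom_sum, LinearMap.sum_apply, ModuleCat.hom_comp,
      LinearMap.comp_apply] at h'
    refine (map_sum c.hom _ _).trans (h'.trans hs)

lemma projective_preadditiveCoyonedaObj_self {C : Type w} [Category.{v} C] [Preadditive C] (G : C) :
    Projective ((preadditiveCoyonedaObj G).obj G) :=
  Projective.of_iso (Preadditive.homSelfLinearEquivEndMulOpposite G).toModuleIso.symm
    ((IsProjective.iff_projective _).1 inferInstance)

lemma projective_preadditiveCoyonedaObj_copower {R : Type u} [Ring R] (I : Type u)
    (G : ModuleCat.{u} R) [Module.Finite R G] :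
    Projective ((preadditiveCoyonedaObj G).obj ((copower _ I).obj G)) := by
  have := preadditiveCoyonedaObj_isIso_desc I G
  have := projective_preadditiveCoyonedaObj_self G
  exact Projective.of_iso (asIso (copower.desc fun i : I => (preadditiveCoyonedaObj G).map
    (copower.ι G i))) inferInstance

/-- Every module over the endomorphism ring of `G` is a quotient of the image of a copower
of `G`. -/
lemma exists_epi_preadditiveCoyonedaObj {R : Type u} [Ring R] (G : ModuleCat.{u} R)
    [Module.Finite R G] (Y : ModuleCat.{u} (End G)ᵐᵒᵖ) :
    ∃ (I : Type u) (f : (preadditiveCoyonedaObj G).obj ((copower _ I).obj G) ⟶ Y), Epi f := by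
  have := preadditiveCoyonedaObj_isIso_desc Y G
  let φ (y : Y) : (preadditiveCoyonedaObj G).obj G ⟶ Y :=
    (Preadditive.homSelfLinearEquivEndMulOpposite G).toModuleIso.hom ≫
      ModuleCat.ofHom (LinearMap.toSpanSingleton _ Y y)
  have : Epi (copower.desc φ) := by
    refine (ModuleCat.epi_iff_surjective _).2 fun y =>
      ⟨(copower.ι ((preadditiveCoyonedaObj G).obj G) y).hom
        ((Preadditive.homSelfLinearEquivEndMulOpposite G).symm 1), ?_⟩
    have h := congrArg (fun f => f.hom ((Preadditive.homSelfLinearEquivEndMulOpposite G).symm 1))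
      (copower.ι_desc φ y)
    refine h.trans ?_
    exact (congrArg (LinearMap.toSpanSingleton _ Y y)
      ((Preadditive.homSelfLinearEquivEndMulOpposite G).apply_symm_apply 1)).trans (one_smul _ y)
  exact ⟨Y, inv (copower.desc fun i => (preadditiveCoyonedaObj G).map (copower.ι G i)) ≫
    copower.desc φ, inferInstance⟩

/-- The essential image of a fully faithful functor is closed under retracts. -/
lemma exists_iso_of_retract {C : Type w} [Category.{v} C] [IsIdempotentComplete C] {D : Type w'}
    [Category.{v} D] (F : C ⥤ D) [F.Full] [F.Faithful] {X : C} {Y : D} (h : Retract Y (F.obj X)) :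
    ∃ X' : C, Nonempty (F.obj X' ≅ Y) := by
  obtain ⟨p, hp⟩ := F.map_surjective (h.r ≫ h.i)
  obtain ⟨X', i, e, hi, he⟩ := IsIdempotentComplete.idempotents_split X p
    (F.map_injective (by simp [hp]))
  refine ⟨X', ⟨⟨F.map i ≫ h.r, h.i ≫ F.map e, ?_, ?_⟩⟩⟩
  · have : h.r ≫ h.i = F.map e ≫ F.map i := by rw [← F.map_comp, he, hp]
    rw [Category.assoc, reassoc_of% this]
    rw [← Category.assoc, ← F.map_comp, hi, F.map_id, Category.id_comp]
  · have : F.map e ≫ F.map i = h.r ≫ h.i := by rw [← F.map_comp, he, hp]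
    rw [Category.assoc, reassoc_of% this]
    simp

variable {Λ}

lemma isSeparator_biprod (N : ModuleCat.{u} Λ) : IsSeparator (ModuleCat.of Λ Λ ⊞ N) := by
  refine (isSeparator_def _).2 fun X Y f g h => ?_
  ext x
  have := h (biprod.fst ≫ ModuleCat.ofHom (LinearMap.toSpanSingleton Λ X x))
  have h' := congrArg (fun t : ModuleCat.of Λ Λ ⊞ N ⟶ Y => (biprod.inl ≫ t).hom 1) this
  simpa using h'

lemma projective_of_self : Projective (ModuleCat.of Λ Λ) :=
  (IsProjective.iff_projective _).1 inferInstance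

lemma StableRetract.biprod_self (N : ModuleCat.{u} Λ) :
    StableRetract (ModuleCat.of Λ Λ ⊞ N) N :=
  ⟨ModuleCat.of Λ Λ, biprod.snd, biprod.inr, biprod.fst, biprod.inl, projective_of_self, by
    rw [add_comm, biprod.total]⟩

lemma StableRetract.self_biprod (N : ModuleCat.{u} Λ) :
    StableRetract N (ModuleCat.of Λ Λ ⊞ N) :=
  .of_retract ⟨biprod.inr, biprod.snd, by simp⟩

lemma epi_preadditiveCoyonedaObj_map_iff (N : ModuleCat.{u} Λ) {X Y : ModuleCat.{u} Λ}
    (f : X ⟶ Y) : Epi ((preadditiveCoyonedaObj (ModuleCat.of Λ Λ ⊞ N)).map f) ↔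
      Epi f ∧ ∀ n : N ⟶ Y, ∃ m : N ⟶ X, m ≫ f = n := by
  have : Projective (ModuleCat.of Λ Λ) := projective_of_self
  have key : Epi ((preadditiveCoyonedaObj (ModuleCat.of Λ Λ ⊞ N)).map f) ↔
      ∀ g : ModuleCat.of Λ Λ ⊞ N ⟶ Y, ∃ g' : ModuleCat.of Λ Λ ⊞ N ⟶ X, g' ≫ f = g :=
    ModuleCat.epi_iff_surjective _
  refine key.trans ⟨fun h => ⟨(ModuleCat.epi_iff_surjective _).2 fun y => ?_, fun n => ?_⟩,
    fun ⟨h, h'⟩ g => ?_⟩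
  · obtain ⟨g, hg⟩ := h (biprod.fst ≫ ModuleCat.ofHom (LinearMap.toSpanSingleton Λ Y y))
    refine ⟨(biprod.inl ≫ g).hom 1, ?_⟩
    have h' : (biprod.inl ≫ g) ≫ f = ModuleCat.ofHom (LinearMap.toSpanSingleton Λ Y y) := by
      simp [hg]
    exact (congrArg (fun t => t.hom (1 : Λ)) h').trans (one_smul Λ y)
  · obtain ⟨g, hg⟩ := h (biprod.snd ≫ n)
    exact ⟨biprod.inr ≫ g, by simp [hg]⟩
  · obtain ⟨m, hm⟩ := h' (biprod.inr ≫ g)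
    exact ⟨biprod.desc (Projective.factorThru (biprod.inl ≫ g) f) m,
      biprod.hom_ext' _ _ (by simp) (by simp [hm])⟩

lemma exists_retract_copower (Q : ModuleCat.{u} Λ) [Projective Q] :
    ∃ I : Type u, Nonempty (Retract Q ((copower _ I).obj (ModuleCat.of Λ Λ))) := by
  let φ : (copower (ModuleCat.{u} Λ) Q).obj (ModuleCat.of Λ Λ) ⟶ Q :=
    copower.desc fun q => ModuleCat.ofHom (LinearMap.toSpanSingleton Λ Q q)
  have : Epi φ := (ModuleCat.epi_iff_surjective _).2 fun q =>
    ⟨(copower.ι (ModuleCat.of Λ Λ) q).hom 1, by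
    have h := congrArg (fun f => f.hom (1 : Λ)) (copower.ι_desc
      (fun q : Q => ModuleCat.ofHom (LinearMap.toSpanSingleton Λ Q q)) q)
    refine h.trans ?_
    simp⟩
  exact ⟨Q, ⟨Projective.factorThru (𝟙 Q) φ, φ, Projective.factorThru_comp _ _⟩⟩

lemma homLike_preadditiveCoyonedaObj (N : ModuleCat.{u} Λ) [Module.Finite Λ N] :
    HomLike (preadditiveCoyonedaObj (ModuleCat.of Λ Λ ⊞ N)) N := by
  set G := ModuleCat.of Λ Λ ⊞ N with hG
  have : Module.Finite Λ G :=
    Module.Finite.equiv (ModuleCat.biprodIsoProd (ModuleCat.of Λ Λ) N).toLinearEquiv.symm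
  have hfull := IsGrothendieckAbelian.GabrielPopescu.full G (isSeparator_biprod N)
  have hfaith := (isSeparator_iff_faithful_preadditiveCoyonedaObj G).1 (isSeparator_biprod N)
  set F := preadditiveCoyonedaObj G with hF
  have hproj (I : Type u) : Projective (F.obj ((copower _ I).obj G)) :=
    projective_preadditiveCoyonedaObj_copower I G
  have hcopower (I : Type u) (X : ModuleCat.{u} Λ) (r : Retract X G) :
      Projective (F.obj ((copower _ I).obj X)) :=
    ((r.map (copower _ I)).map F).projective
  refine ⟨epi_preadditiveCoyonedaObj_map_iff N, fun X => ⟨fun _ => ?_, fun ⟨I, h⟩ => ?_⟩,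
    fun Y hY => ?_⟩
  · obtain ⟨I, f, hf⟩ := exists_epi_preadditiveCoyonedaObj G (F.obj X)
    obtain ⟨r, hr⟩ := F.map_surjective f
    obtain ⟨i, hi⟩ := F.map_surjective (Projective.factorThru (𝟙 _) f)
    have hir : i ≫ r = 𝟙 X := F.map_injective (by
      rw [F.map_comp, hi, hr, Projective.factorThru_comp, F.map_id])
    exact ⟨I, (StableRetract.of_retract ⟨i, r, hir⟩).trans
      ((StableRetract.biprod_self N).map (copower _ I) fun P hP => inferInstance)⟩
  · obtain ⟨Q, i, r, a, b, hQ, e⟩ := h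
    obtain ⟨J, ⟨s⟩⟩ := exists_retract_copower Q
    have h₁ : Projective (F.obj ((copower _ I).obj N)) :=
      hcopower I N ⟨biprod.inr, biprod.snd, by simp⟩
    have h₂ : Projective (F.obj Q) :=
      have := hcopower J (ModuleCat.of Λ Λ) ⟨biprod.inl, biprod.fst, by simp⟩
      (s.map F).projective
    refine Retract.projective (Y := F.obj ((copower _ I).obj N) ⊞ F.obj Q)
      ⟨biprod.lift (F.map i) (F.map a), biprod.desc (F.map r) (F.map b), ?_⟩
    rw [biprod.lift_desc, ← F.map_comp, ← F.map_comp, ← F.map_add, e, F.map_id]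
  · obtain ⟨I, f, hf⟩ := exists_epi_preadditiveCoyonedaObj G Y
    exact exists_iso_of_retract F
      ⟨Projective.factorThru (𝟙 _) f, f, Projective.factorThru_comp _ _⟩

lemma HomLike.comp_equivalence {C : Type w} [Category.{v} C] [Abelian C] [HasCoproducts.{v} C]
    {D D' : Type w'} [Category.{v} D] [Category.{v} D'] {F : C ⥤ D} {N : C} (h : HomLike F N)
    (E : D ⥤ D') [E.IsEquivalence] : HomLike (F ⋙ E) N where
  epi_map_iff f := (E.epi_map_iff_epi _).trans (h.epi_map_iff f)
  projective_iff X := (E.asEquivalence.map_projective_iff _).trans (h.projective_iff X)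
  exists_iso Y hY := by
    obtain ⟨X, ⟨e⟩⟩ := h.exists_iso (E.inv.obj Y)
      ((E.asEquivalence.symm.map_projective_iff Y).2 hY)
    exact ⟨X, ⟨E.mapIso e ≪≫ E.asEquivalence.counitIso.app Y⟩⟩

end EndomorphismRing

section Transport

/-- The endomorphism ring in the opposite category is the opposite of the endomorphism ring. -/
def endOpEquiv {C : Type*} [Category* C] [Preadditive C] (G : C) : End (op G) ≃+* (End G)ᵐᵒᵖ where
  toFun f := .op f.unop
  invFun f := f.unop.op
  left_inv _ := rfl
  right_inv _ := rfl
  map_mul' _ _ := rfl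
  map_add' _ _ := rfl

variable {Λ}

/-- The functor `Hom(G, -)` to modules over the ring `End (op G)`. -/
noncomputable abbrev homFunctor (G : ModuleCat.{u} Λ) :
    ModuleCat.{u} Λ ⥤ ModuleCat.{u} (End (op G)) :=
  preadditiveCoyonedaObj G ⋙
    (ModuleCat.restrictScalarsEquivalenceOfRingEquiv (endOpEquiv G)).functor

noncomputable def homFunctorSelfIso (G : ModuleCat.{u} Λ) :
    (homFunctor G).obj G ≅ ModuleCat.of (End (op G)) (End (op G)) :=
  (ModuleCat.restrictScalars (endOpEquiv G).toRingHom).mapIso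
    (Preadditive.homSelfLinearEquivEndMulOpposite G).toModuleIso ≪≫
      ModuleCat.restrictScalarsIsoOfEquiv (endOpEquiv G)

lemma homFunctor_full (N : ModuleCat.{u} Λ) : (homFunctor (ModuleCat.of Λ Λ ⊞ N)).Full :=
  have := IsGrothendieckAbelian.GabrielPopescu.full _ (isSeparator_biprod N)
  inferInstance

lemma homFunctor_faithful (N : ModuleCat.{u} Λ) : (homFunctor (ModuleCat.of Λ Λ ⊞ N)).Faithful :=
  have := (isSeparator_iff_faithful_preadditiveCoyonedaObj _).1 (isSeparator_biprod N)
  inferInstance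

lemma homFunctor_preservesInjectiveObjects (N : ModuleCat.{u} Λ) :
    (homFunctor (ModuleCat.of Λ Λ ⊞ N)).PreservesInjectiveObjects where
  injective_obj _ :=
    have := IsGrothendieckAbelian.GabrielPopescu.preservesInjectiveObjects _ (isSeparator_biprod N)
    ((ModuleCat.restrictScalarsEquivalenceOfRingEquiv _).map_injective_iff _).2
      ((preadditiveCoyonedaObj _).injective_obj _)

variable (T : ShortComplex (ModuleCat.{u} Λ)) (hT : T.ShortExact) [Projective T.X₂]
    [Module.Finite Λ T.X₁] [Module.Finite Λ T.X₃]
  (hPI : ∀ X : ModuleCat.{u} Λ, Projective X ↔ Injective X)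

include hT hPI

lemma gldimLE_end_iff_of_shortExact (r : ℕ) :
    GldimLE (End (op (ModuleCat.of Λ Λ ⊞ T.X₃))) r ↔
      GldimLE (End (op (ModuleCat.of Λ Λ ⊞ T.X₁))) r := by
  have := homFunctor_full T.X₃; have := homFunctor_full T.X₁
  have := homFunctor_faithful T.X₃; have := homFunctor_faithful T.X₁
  rw [gldimLE_iff, gldimLE_iff]
  exact HomLike.forall_hasProjectiveDimensionLT_iff_of_syzygy
    (F := homFunctor (ModuleCat.of Λ Λ ⊞ T.X₃)) (F' := homFunctor (ModuleCat.of Λ Λ ⊞ T.X₁))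
    hPI hT ((homLike_preadditiveCoyonedaObj T.X₃).comp_equivalence _)
    ((homLike_preadditiveCoyonedaObj T.X₁).comp_equivalence _) r

lemma domdimGE_end_iff_of_shortExact (r : ℕ) :
    DomdimGE (End (op (ModuleCat.of Λ Λ ⊞ T.X₃))) r ↔
      DomdimGE (End (op (ModuleCat.of Λ Λ ⊞ T.X₁))) r := by
  have := homFunctor_full T.X₃; have := homFunctor_full T.X₁
  have := homFunctor_faithful T.X₃; have := homFunctor_faithful T.X₁
  have := homFunctor_preservesInjectiveObjects T.X₃
  have := homFunctor_preservesInjectiveObjects T.X₁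
  have h := HomLike.domdimObjGE_iff_of_syzygy
    (F := homFunctor (ModuleCat.of Λ Λ ⊞ T.X₃)) (F' := homFunctor (ModuleCat.of Λ Λ ⊞ T.X₁))
    hPI hT ((homLike_preadditiveCoyonedaObj T.X₃).comp_equivalence _)
    ((homLike_preadditiveCoyonedaObj T.X₁).comp_equivalence _)
    (.biprod_self _) (.self_biprod _) (.biprod_self _) (.self_biprod _) r
  rw [domdimGE_iff, domdimGE_iff]
  exact ⟨fun h' => (h.1 (h'.of_iso (homFunctorSelfIso _).symm)).of_iso (homFunctorSelfIso _),
    fun h' => (h.2 (h'.of_iso (homFunctorSelfIso _).symm)).of_iso (homFunctorSelfIso _)⟩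

end Transport

/-- A projective cover of a finitely generated module is finitely generated. -/
lemma finite_of_isRightMinimal {R : Type u} [Ring R] {N P : ModuleCat.{u} R} [Module.Finite R N]
    [Projective P] (p : P ⟶ N) [Epi p] (hmin : ∀ h : P ⟶ P, h ≫ p = p → IsIso h) :
    Module.Finite R P := by
  obtain ⟨n, f, hf⟩ := Module.Finite.exists_fin' R N
  let f' : ModuleCat.of R (Fin n → R) ⟶ N := ModuleCat.ofHom f
  have : Epi f' := (ModuleCat.epi_iff_surjective _).2 hf
  have : Projective (ModuleCat.of R (Fin n → R)) :=
    (IsProjective.iff_projective _).1 inferInstance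
  let t := Projective.factorThru f' p
  have := hmin (Projective.factorThru p f' ≫ t) (by simp [t])
  have : Epi t := epi_of_epi (Projective.factorThru p f') t
  exact Module.Finite.of_surjective t.hom ((ModuleCat.epi_iff_surjective t).1 inferInstance)

/-- Lemma `HS`: for a self-injective algebra `Λ` and a module `N`,
the algebras `End_Λ(Λ ⊕ N)` and `End_Λ(Λ ⊕ Ω_Λ(N))` have the same global dimension
and the same dominant dimension; here `Ω_Λ(N)` is the kernel of a projective cover
`p : P ⟶ N`. -/
theorem statement11 (k : Type u) [Field k] (Λ : Type u) [Ring Λ] [Algebra k Λ]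
    [FiniteDimensional k Λ]
    (hselfinj : Injective (ModuleCat.of Λ Λ))
    (N : ModuleCat.{u} Λ) (hNfin : Module.Finite Λ N)
    (P : ModuleCat.{u} Λ) (p : P ⟶ N) (hP : Projective P) (hpe : Epi p)
    (hmin : ∀ h : P ⟶ P, h ≫ p = p → IsIso h) :
    gldim (End (op ((ModuleCat.of Λ Λ) ⊞ N))) =
      gldim (End (op ((ModuleCat.of Λ Λ) ⊞ (kernel p)))) ∧
    domdim (End (op ((ModuleCat.of Λ Λ) ⊞ N))) =
      domdim (End (op ((ModuleCat.of Λ Λ) ⊞ (kernel p)))) := by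
  have := hNfin
  have : Module.Injective Λ Λ := (Module.injective_iff_injective_object Λ Λ).2 hselfinj
  have hPI (X : ModuleCat.{u} Λ) : Projective X ↔ Injective X := by
    rw [← IsProjective.iff_projective, ← Module.injective_iff_injective_object,
      module_projective_iff_injective k]
  have := finite_of_isRightMinimal p hmin
  have : IsNoetherianRing Λ := isNoetherian_of_tower k inferInstance
  have : Module.Finite Λ (kernel p : ModuleCat.{u} Λ) :=
    Module.Finite.of_injective (kernel.ι p).hom ((ModuleCat.mono_iff_injective _).1 inferInstance)
  have hT := shortExact_kernel p
  constructor
  · simp only [gldim, gldimLE_end_iff_of_shortExact _ hT hPI]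
  · simp only [domdim, domdimGE_end_iff_of_shortExact _ hT hPI]

end Rigidity
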